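/- Let 0 < λ ≤ Λ, let F be (λ,Λ)-elliptic with F(0) = 0, let β : ℝ → ℝ be a smooth, nonnegative function with compact support, and for ε > 0 set β_ε(s) := ε^{−1}β(s/ε). Let Ω ⊂ ℝⁿ be open and bounded, let Ω' be open with compact closure contained in Ω, let φ : Ω → ℝ be Lipschitz with Lipschitz constant [φ], and let {u_ε}_{ε>0} be a family of continuously differentiable classical viscosity solutions of F(D²u_ε) = β_ε(u_ε − φ) in Ω with u_ε ≥ φ in Ω and sup_ε ‖u_ε‖_{L^∞(Ω)} =: M < ∞. Then there exists a constant C' > 0, depending only on n, λ, Λ, β, [φ], M, Ω' and Ω, but independent of ε, such that ‖Du_ε‖_{L^∞(Ω')} ≤ C' for every ε > 0. -/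

import Mathlib

open Metric Set Matrix MeasureTheory
open scoped RealInnerProductSpace

noncomputable section

abbrev Euc (n : ℕ) := EuclideanSpace ℝ (Fin n)

def EllMat (n : ℕ) (lam Lam : ℝ) : Set (Matrix (Fin n) (Fin n) ℝ) :=
  {A | A.IsSymm ∧ ∀ ξ : Fin n → ℝ,
      lam * (ξ ⬝ᵥ ξ) ≤ ξ ⬝ᵥ A.mulVec ξ ∧ ξ ⬝ᵥ A.mulVec ξ ≤ Lam * (ξ ⬝ᵥ ξ)}

/-- Pucci maximal operator `M⁺`. -/
def pucciSup (n : ℕ) (lam Lam : ℝ) (M : Matrix (Fin n) (Fin n) ℝ) : ℝ :=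
  sSup ((fun A => (A * M).trace) '' EllMat n lam Lam)

/-- Pucci minimal operator `M⁻`. -/
def pucciInf (n : ℕ) (lam Lam : ℝ) (M : Matrix (Fin n) (Fin n) ℝ) : ℝ :=
  sInf ((fun A => (A * M).trace) '' EllMat n lam Lam)

/-- `(λ,Λ)`-ellipticity of `F`. -/
def IsUniformlyElliptic (n : ℕ) (lam Lam : ℝ)
    (F : Matrix (Fin n) (Fin n) ℝ → ℝ) : Prop :=
  ∀ M N : Matrix (Fin n) (Fin n) ℝ, M.IsSymm → N.IsSymm →
    pucciInf n lam Lam (M - N) ≤ F M - F N ∧ F M - F N ≤ pucciSup n lam Lam (M - N)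

/-- Hessian matrix of `φ` at `x`. -/
def hess {n : ℕ} (φ : Euc n → ℝ) (x : Euc n) : Matrix (Fin n) (Fin n) ℝ :=
  fun i j => iteratedFDeriv ℝ 2 φ x ![EuclideanSpace.single i 1, EuclideanSpace.single j 1]

/-- `κ`-grad viscosity subsolution of `G(Du, D²u) = f` in `s`. -/
def GradSubSol {n : ℕ} (κ : ℝ) (G : Euc n → Matrix (Fin n) (Fin n) ℝ → ℝ)
    (f : Euc n → ℝ) (s : Set (Euc n)) (u : Euc n → ℝ) : Prop :=
  ∀ x₀ ∈ s, ∀ φ : Euc n → ℝ, ContDiff ℝ 2 φ →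
    IsLocalMax (fun x => u x - φ x) x₀ → κ < ‖gradient φ x₀‖ →
    f x₀ ≤ G (gradient φ x₀) (hess φ x₀)

/-- `κ`-grad viscosity supersolution of `G(Du, D²u) = f` in `s`. -/
def GradSupSol {n : ℕ} (κ : ℝ) (G : Euc n → Matrix (Fin n) (Fin n) ℝ → ℝ)
    (f : Euc n → ℝ) (s : Set (Euc n)) (u : Euc n → ℝ) : Prop :=
  ∀ x₀ ∈ s, ∀ φ : Euc n → ℝ, ContDiff ℝ 2 φ →
    IsLocalMin (fun x => u x - φ x) x₀ → κ < ‖gradient φ x₀‖ →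
    G (gradient φ x₀) (hess φ x₀) ≤ f x₀

/-- `κ`-grad viscosity solution. -/
def GradSol {n : ℕ} (κ : ℝ) (G : Euc n → Matrix (Fin n) (Fin n) ℝ → ℝ)
    (f : Euc n → ℝ) (s : Set (Euc n)) (u : Euc n → ℝ) : Prop :=
  GradSubSol κ G f s u ∧ GradSupSol κ G f s u

/-- Classical viscosity solution (no restriction on the slope of test functions). -/
def ViscSol {n : ℕ} (G : Euc n → Matrix (Fin n) (Fin n) ℝ → ℝ)
    (f : Euc n → ℝ) (s : Set (Euc n)) (u : Euc n → ℝ) : Prop :=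
  (∀ x₀ ∈ s, ∀ φ : Euc n → ℝ, ContDiff ℝ 2 φ →
    IsLocalMax (fun x => u x - φ x) x₀ → f x₀ ≤ G (gradient φ x₀) (hess φ x₀)) ∧
  (∀ x₀ ∈ s, ∀ φ : Euc n → ℝ, ContDiff ℝ 2 φ →
    IsLocalMin (fun x => u x - φ x) x₀ → G (gradient φ x₀) (hess φ x₀) ≤ f x₀)

/-- The operator `G(ξ, M) = (|ξ|-κ)₊^q F(M)`. -/
def mainG {n : ℕ} (κ q : ℝ) (F : Matrix (Fin n) (Fin n) ℝ → ℝ) :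
    Euc n → Matrix (Fin n) (Fin n) ℝ → ℝ :=
  fun ξ M => max (‖ξ‖ - κ) 0 ^ q * F M

/-- The set `Ω_u` of points of `s` that can be touched from above or below by a `C²`
function with slope larger than `κ`. -/
def omegaSet {n : ℕ} (κ : ℝ) (s : Set (Euc n)) (u : Euc n → ℝ) : Set (Euc n) :=
  {x ∈ s | ∃ φ : Euc n → ℝ, ContDiff ℝ 2 φ ∧
    (IsLocalMax (fun y => u y - φ y) x ∨ IsLocalMin (fun y => u y - φ y) x) ∧
    κ < ‖gradient φ x‖}

/-- Effective viscosity solution of `(|Du|-κ)₊^q F(D²u) = f` in `s`. -/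
def EffectiveSol {n : ℕ} (κ q : ℝ) (F : Matrix (Fin n) (Fin n) ℝ → ℝ)
    (f : Euc n → ℝ) (s : Set (Euc n)) (u : Euc n → ℝ) : Prop :=
  IsOpen (omegaSet κ s u) ∧ ViscSol (mainG κ q F) f (omegaSet κ s u) u

section Regularity

open Filter Topology

/-- `Q` selects, at every point, a subgradient of `G` up to a quadratic error of size `C / 2`. -/
def IsSemiconvexWith {E : Type*} [NormedAddCommGroup E] [InnerProductSpace ℝ E]
    (C : ℝ) (G : E → ℝ) (Q : E → E) : Prop :=
  ∀ w e, G w + ⟪Q w, e⟫ - C / 2 * ‖e‖ ^ 2 ≤ G (w + e)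

section Semiconvex

variable {E : Type*} [NormedAddCommGroup E] [InnerProductSpace ℝ E]

theorem IsSemiconvexWith.eq_of_eventually_le {C : ℝ} {G : E → ℝ} {Q : E → E}
    (hQ : IsSemiconvexWith C G Q) {z p : E}
    (h : ∀ᶠ e in 𝓝 (0 : E), G (z + e) ≤ G z + ⟪p, e⟫) : Q z = p := by
  by_contra hne
  have hpos : 0 < ‖Q z - p‖ ^ 2 := by
    have : 0 < ‖Q z - p‖ := norm_pos_iff.2 (sub_ne_zero.2 hne)
    positivity
  have hc : Tendsto (fun t : ℝ => t • (Q z - p)) (𝓝[>] 0) (𝓝 (0 : E)) := by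
    have : Tendsto (fun t : ℝ => t • (Q z - p)) (𝓝 0) (𝓝 ((0 : ℝ) • (Q z - p))) :=
      (continuous_id.smul continuous_const).tendsto 0
    rw [zero_smul] at this
    exact this.mono_left nhdsWithin_le_nhds
  have h2 : Tendsto (fun t : ℝ => 1 - C / 2 * t) (𝓝[>] 0) (𝓝 1) := by
    have : Tendsto (fun t : ℝ => 1 - C / 2 * t) (𝓝 0) (𝓝 (1 - C / 2 * 0)) :=
      (by fun_prop : Continuous fun t : ℝ => 1 - C / 2 * t).tendsto 0
    simp only [mul_zero, sub_zero] at this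
    exact this.mono_left nhdsWithin_le_nhds
  obtain ⟨t, ht1, ht2, ht0⟩ := ((hc.eventually h).and
    ((h2.eventually (lt_mem_nhds zero_lt_one)).and self_mem_nhdsWithin)).exists
  have ht0 : 0 < t := ht0
  have h3 := hQ z (t • (Q z - p))
  have h4 : ⟪Q z, t • (Q z - p)⟫ - ⟪p, t • (Q z - p)⟫ = t * ‖Q z - p‖ ^ 2 := by
    rw [← inner_sub_left, inner_smul_right, real_inner_self_eq_norm_sq]
  have h5 : ‖t • (Q z - p)‖ ^ 2 = t ^ 2 * ‖Q z - p‖ ^ 2 := by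
    rw [norm_smul, mul_pow, Real.norm_eq_abs, sq_abs]
  rw [h5] at h3
  have h6 : t * ‖Q z - p‖ ^ 2 * (1 - C / 2 * t) ≤ 0 := by nlinarith
  have : 0 < t * ‖Q z - p‖ ^ 2 * (1 - C / 2 * t) := by positivity
  linarith

theorem IsSemiconvexWith.norm_sub_le {C : ℝ} {G : E → ℝ} {Q : E → E}
    (hQ : IsSemiconvexWith C G Q) {r : ℝ} (hr : 0 < r) {k w : E}
    (hk : ‖k‖ ≤ r / 3) (hw : ‖w‖ ≤ r / 3)
    (h : ∀ v, ‖v‖ ≤ r → G v ≤ G k + ⟪Q k, v - k⟫) : ‖Q w - Q k‖ ≤ C * ‖w - k‖ := by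
  rcases eq_or_ne (Q w) (Q k) with he | hne
  · rcases eq_or_ne w k with rfl | hwk
    · simp
    have hd : 0 < ‖w - k‖ ^ 2 := by
      have : 0 < ‖w - k‖ := norm_pos_iff.2 (sub_ne_zero.2 hwk)
      positivity
    have h1 := hQ k (w - k)
    have h2 := h w (by linarith)
    rw [add_sub_cancel] at h1
    have h3 : 0 ≤ C := by
      by_contra hC
      push Not at hC
      nlinarith
    simp [he]
    positivity
  have hp : 0 < ‖Q w - Q k‖ := norm_pos_iff.2 (sub_ne_zero.2 hne)
  rcases eq_or_ne w k with rfl | hwk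
  · exact absurd rfl hne
  have hd : 0 < ‖w - k‖ := norm_pos_iff.2 (sub_ne_zero.2 hwk)
  set s := ‖w - k‖ / ‖Q w - Q k‖ with hs
  have hs0 : 0 < s := by positivity
  set e := s • (Q w - Q k) with he
  have hen : ‖e‖ = ‖w - k‖ := by
    rw [he, norm_smul, Real.norm_of_nonneg hs0.le, hs]
    field_simp
  have hwk2 : ‖w - k‖ ≤ 2 * r / 3 := by
    have := _root_.norm_sub_le w k
    linarith
  have h1 := h (w + e) (by
    have := norm_add_le w e
    linarith)
  have h2 := hQ w e
  have h3 := hQ k (w - k)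
  rw [add_sub_cancel] at h3
  have h4 : ⟪Q w, e⟫ - ⟪Q k, e⟫ = ‖w - k‖ * ‖Q w - Q k‖ := by
    rw [← inner_sub_left, he, inner_smul_right, real_inner_self_eq_norm_sq, hs]
    field_simp
  have h5 : ⟪Q k, w + e - k⟫ = ⟪Q k, w - k⟫ + ⟪Q k, e⟫ := by
    rw [← inner_add_right]
    congr 1
    abel
  rw [hen] at h2
  have h6 : ‖w - k‖ * ‖Q w - Q k‖ ≤ ‖w - k‖ * (C * ‖w - k‖) := by nlinarith
  exact le_of_mul_le_mul_left h6 hd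

theorem abs_sub_le_of_abs_sub_le_add_sq {f : ℝ → ℝ} {a b : ℝ}
    (h : ∀ t s, 0 ≤ t → 0 ≤ s → t + s ≤ 1 → |f (t + s) - f t| ≤ a * s + b * s ^ 2) :
    |f 1 - f 0| ≤ a := by
  have key : ∀ m : ℕ, |f 1 - f 0| ≤ a + b / ((m : ℝ) + 1) := by
    intro m
    have hm : (0 : ℝ) < (m : ℝ) + 1 := by positivity
    have h1 : ∀ k : ℕ, k ≤ m + 1 →
        |f (k / ((m : ℝ) + 1)) - f 0| ≤ k * (a / (m + 1) + b / (m + 1) ^ 2) := by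
      intro k
      induction k with
      | zero => intro _; simp
      | succ k ih =>
        intro hk
        have ih := ih (by omega)
        have hk' : (k : ℝ) + 1 ≤ m + 1 := by exact_mod_cast hk
        have h2 := h (k / ((m : ℝ) + 1)) (1 / ((m : ℝ) + 1)) (by positivity) (by positivity)
          (by rw [← add_div, div_le_one hm]; exact hk')
        rw [← add_div] at h2
        have h3 : a * (1 / ((m : ℝ) + 1)) + b * (1 / ((m : ℝ) + 1)) ^ 2
          = a / (m + 1) + b / (m + 1) ^ 2 := by
          field_simp
        push_cast
        rw [h3] at h2
        have h4 := abs_add_le (f (((k : ℝ) + 1) / (m + 1)) - f (k / ((m : ℝ) + 1)))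
          (f (k / ((m : ℝ) + 1)) - f 0)
        rw [sub_add_sub_cancel] at h4
        linarith
    have h2 := h1 (m + 1) le_rfl
    push_cast at h2
    rw [div_self hm.ne'] at h2
    convert h2 using 1
    field_simp
  have hlim : Tendsto (fun m : ℕ => a + b / ((m : ℝ) + 1)) atTop (𝓝 (a + 0)) := by
    refine tendsto_const_nhds.add ?_
    have := (tendsto_one_div_add_atTop_nhds_zero_nat (𝕜 := ℝ)).const_mul b
    simpa [div_eq_mul_inv] using this
  rw [add_zero] at hlim
  exact ge_of_tendsto' hlim key

theorem IsSemiconvexWith.expansion_of_hasFDerivAt {C : ℝ} {G : E → ℝ} {Q : E → E}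
    (hQ : IsSemiconvexWith C G Q) {z : E} {D : E →L[ℝ] E} (hD : HasFDerivAt Q D z)
    {θ : ℝ} (hθ : 0 < θ) :
    ∀ᶠ h in 𝓝 (0 : E), |G (z + h) - G z - ⟪Q z, h⟫ - ⟪D h, h⟫ / 2| ≤ θ * ‖h‖ ^ 2 := by
  have h1 : ∀ᶠ h in 𝓝 (0 : E), ‖Q (z + h) - Q z - D h‖ ≤ θ * ‖h‖ :=
    (hasFDerivAt_iff_isLittleO_nhds_zero.1 hD).def hθ
  obtain ⟨ρ, hρ, hb⟩ := Metric.eventually_nhds_iff_ball.1 h1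
  filter_upwards [ball_mem_nhds (0 : E) hρ] with h hh
  have hq : ∀ t : ℝ, 0 ≤ t → t ≤ 1 →
      |⟪Q (z + t • h), h⟫ - ⟪Q z, h⟫ - t * ⟪D h, h⟫| ≤ θ * t * ‖h‖ ^ 2 := by
    intro t ht0 ht1
    have hth : ‖t • h‖ = t * ‖h‖ := by rw [norm_smul, Real.norm_of_nonneg ht0]
    have h2 := hb (t • h) (by
      rw [mem_ball_zero_iff] at hh ⊢
      rw [hth]
      nlinarith [norm_nonneg h])
    have h3 : ⟪Q (z + t • h), h⟫ - ⟪Q z, h⟫ - t * ⟪D h, h⟫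
        = ⟪Q (z + t • h) - Q z - D (t • h), h⟫ := by
      rw [inner_sub_left, inner_sub_left, map_smul, inner_smul_left]
      simp
    rw [h3]
    refine (abs_real_inner_le_norm _ _).trans ?_
    rw [hth] at h2
    nlinarith [norm_nonneg h]
  have hmain := abs_sub_le_of_abs_sub_le_add_sq
    (f := fun t : ℝ => G (z + t • h) - t * ⟪Q z, h⟫ - t ^ 2 / 2 * ⟪D h, h⟫)
    (a := θ * ‖h‖ ^ 2) (b := (C * ‖h‖ ^ 2 + |⟪D h, h⟫|) / 2) (by
      intro t s ht hs hts
      have hl := hQ (z + t • h) (s • h)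
      have hu := hQ (z + (t + s) • h) (-(s • h))
      rw [show z + t • h + s • h = z + (t + s) • h by module] at hl
      rw [show z + (t + s) • h + -(s • h) = z + t • h by module] at hu
      rw [norm_neg, inner_neg_right] at hu
      rw [norm_smul, mul_pow, Real.norm_eq_abs, sq_abs, inner_smul_right] at hl hu
      have q1 := abs_le.1 (hq t ht (by linarith))
      have q2 := abs_le.1 (hq (t + s) (by linarith) hts)
      have d1 := le_abs_self ⟪D h, h⟫
      have d2 := neg_abs_le ⟪D h, h⟫
      have hn : 0 ≤ θ * ‖h‖ ^ 2 := by positivity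
      have e1 := mul_le_mul_of_nonneg_left q1.1 hs
      have e2 := mul_le_mul_of_nonneg_left q2.2 hs
      have e3 : s * (θ * (t + s) * ‖h‖ ^ 2) ≤ θ * ‖h‖ ^ 2 * s := by
        nlinarith [mul_nonneg hn hs]
      have e4 : s * (θ * t * ‖h‖ ^ 2) ≤ θ * ‖h‖ ^ 2 * s := by
        nlinarith [mul_nonneg hn hs]
      have e5 := mul_le_mul_of_nonneg_left d1 (sq_nonneg s)
      have e6 := mul_le_mul_of_nonneg_left d2 (sq_nonneg s)
      rw [abs_le]
      constructor <;> nlinarith)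
  simp only [one_smul, zero_smul, add_zero, one_mul, zero_mul] at hmain
  refine le_trans (le_of_eq ?_) hmain
  congr 1
  ring

end Semiconvex

section SecondOrder

variable {E : Type*} [NormedAddCommGroup E] [InnerProductSpace ℝ E]

theorem exists_mem_near_of_density [MeasurableSpace E] [BorelSpace E] [FiniteDimensional ℝ E]
    (μ : Measure E) [μ.IsAddHaarMeasure] (K : Set E) :
    ∀ᵐ z ∂μ.restrict K, ∀ θ > 0, ∀ᶠ h in 𝓝[≠] (0 : E), ∃ k ∈ K, ‖k - (z + h)‖ ≤ θ * ‖h‖ := by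
  have h1 : ∀ᵐ z ∂μ.restrict K, ∀ m : ℕ, ∀ᶠ h in 𝓝[≠] (0 : E),
      ∃ k ∈ K, ‖k - (z + h)‖ ≤ 1 / ((m : ℝ) + 1) * ‖h‖ := by
    rw [ae_all_iff]
    intro m
    have hm : (0 : ℝ) < (m : ℝ) + 1 := by positivity
    filter_upwards [IsUnifLocDoublingMeasure.ae_tendsto_measure_inter_div μ K ((m : ℝ) + 1)]
      with z hz
    have hlim := hz (l := 𝓝[≠] (0 : E)) (fun h => z + h) (fun h => 1 / ((m : ℝ) + 1) * ‖h‖)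
      (by
        refine tendsto_nhdsWithin_iff.2 ⟨?_, ?_⟩
        · have : Tendsto (fun h : E => 1 / ((m : ℝ) + 1) * ‖h‖) (𝓝 0)
              (𝓝 (1 / ((m : ℝ) + 1) * ‖(0 : E)‖)) :=
            (by fun_prop : Continuous fun h : E => 1 / ((m : ℝ) + 1) * ‖h‖).tendsto 0
          rw [norm_zero, mul_zero] at this
          exact this.mono_left nhdsWithin_le_nhds
        · filter_upwards [self_mem_nhdsWithin] with h hh
          have : 0 < ‖h‖ := norm_pos_iff.2 hh
          exact mem_Ioi.2 (by positivity))
      (Eventually.of_forall fun h => by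
        rw [mem_closedBall, dist_eq_norm]
        have : z - (z + h) = -h := by abel
        rw [this, norm_neg]
        apply le_of_eq
        field_simp)
    filter_upwards [hlim.eventually (lt_mem_nhds zero_lt_one)] with h hh
    have hne : μ (K ∩ closedBall (z + h) (1 / ((m : ℝ) + 1) * ‖h‖)) ≠ 0 := by
      intro h0
      rw [h0, ENNReal.zero_div] at hh
      exact lt_irrefl _ hh
    obtain ⟨k, hk1, hk2⟩ := nonempty_of_measure_ne_zero hne
    exact ⟨k, hk1, by rwa [mem_closedBall, dist_eq_norm] at hk2⟩
  filter_upwards [h1] with z hz θ hθ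
  obtain ⟨m, hm⟩ := exists_nat_one_div_lt hθ
  filter_upwards [hz m] with h ⟨k, hk1, hk2⟩
  exact ⟨k, hk1, hk2.trans (by gcongr)⟩

theorem hasFDerivAt_of_hasFDerivWithinAt_of_dense {Q : E → E} {K : Set E} {z : E} {D : E →L[ℝ] E}
    {C r : ℝ} (hr : 0 < r) (hC : 0 ≤ C) (hD : HasFDerivWithinAt Q D K z)
    (hlip : ∀ k ∈ K, ∀ w, ‖w - z‖ ≤ r → ‖Q w - Q k‖ ≤ C * ‖w - k‖)
    (hdense : ∀ θ > 0, ∀ᶠ h in 𝓝[≠] (0 : E), ∃ k ∈ K, ‖k - (z + h)‖ ≤ θ * ‖h‖) :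
    HasFDerivAt Q D z := by
  rw [hasFDerivAt_iff_isLittleO_nhds_zero]
  refine Asymptotics.IsLittleO.of_bound fun c hc => ?_
  set θ := min 1 (c / (2 + C + ‖D‖)) with hθ
  have hden : 0 < 2 + C + ‖D‖ := by positivity
  have hθ0 : 0 < θ := by positivity
  have hθ1 : θ ≤ 1 := min_le_left _ _
  have hθ2 : θ * (2 + C + ‖D‖) ≤ c := by
    rw [← le_div_iff₀ hden]
    exact min_le_right _ _
  have h1 := hasFDerivWithinAt_iff_isLittleO.1 hD |>.def hθ0
  rw [eventually_nhdsWithin_iff] at h1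
  obtain ⟨ρ, hρ, hb⟩ := Metric.eventually_nhds_iff_ball.1 h1
  have h2 := eventually_nhdsWithin_iff.1 (hdense θ hθ0)
  filter_upwards [h2, ball_mem_nhds (0 : E) (by positivity : 0 < min r (ρ / 2))] with h hd hh
  rcases eq_or_ne h 0 with rfl | hne
  · simp
  obtain ⟨k, hk, hkd⟩ := hd hne
  rw [mem_ball_zero_iff, lt_min_iff] at hh
  have e1 := hlip k hk (z + h) (by simpa using hh.1.le)
  rw [← norm_neg (z + h - k), neg_sub] at e1
  have hkz : ‖k - z‖ ≤ 2 * ‖h‖ := by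
    have := norm_add_le (k - (z + h)) h
    rw [show k - (z + h) + h = k - z by abel] at this
    nlinarith [norm_nonneg h]
  have e2 := hb k (by
    rw [mem_ball, dist_eq_norm]
    linarith [hh.2]) hk
  have e3 : ‖D (k - (z + h))‖ ≤ ‖D‖ * (θ * ‖h‖) :=
    (D.le_opNorm _).trans (by gcongr)
  have e4 : Q (z + h) - Q z - D h
      = (Q (z + h) - Q k) + (Q k - Q z - D (k - z)) + D (k - (z + h)) := by
    simp only [map_sub, map_add]
    abel
  rw [e4]
  refine (norm_add₃_le).trans ?_
  have e5 : C * ‖k - (z + h)‖ ≤ C * (θ * ‖h‖) := by gcongr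
  have e6 : θ * ‖k - z‖ ≤ θ * (2 * ‖h‖) := by gcongr
  calc _ ≤ C * (θ * ‖h‖) + θ * (2 * ‖h‖) + ‖D‖ * (θ * ‖h‖) := by linarith
    _ = θ * (2 + C + ‖D‖) * ‖h‖ := by ring
    _ ≤ c * ‖h‖ := by gcongr

/-- A semiconvex function with a strict quadratic maximum has, arbitrarily close to the maximum
point, a point with a second order expansion, small gradient and nonpositive Hessian. -/
theorem IsSemiconvexWith.exists_expansion_near_max [FiniteDimensional ℝ E] {C : ℝ} {G : E → ℝ}
    {Q : E → E} (hQ : IsSemiconvexWith C G Q) (hC : 0 ≤ C) (hG : Continuous G) {η r : ℝ}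
    (hη : 0 < η) (hr : 0 < r) (hmax : ∀ w, ‖w‖ ≤ r → G w + η * ‖w‖ ^ 2 ≤ G 0)
    {τ : ℝ} (hτ : 0 < τ) :
    ∃ z : E, ∃ D : E →L[ℝ] E, ‖z‖ ≤ τ ∧ ‖Q z‖ ≤ τ ∧ (∀ h, ⟪D h, h⟫ ≤ 0) ∧
      ∀ θ > 0, ∀ᶠ h in 𝓝 (0 : E), |G (z + h) - G z - ⟪Q z, h⟫ - ⟪D h, h⟫ / 2| ≤ θ * ‖h‖ ^ 2 := by
  let _ : MeasurableSpace E := borel E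
  have : BorelSpace E := ⟨rfl⟩
  set μ : Measure E := Measure.hausdorffMeasure (Module.finrank ℝ E) with hμ
  have : μ.IsAddHaarMeasure := MeasureTheory.isAddHaarMeasure_hausdorffMeasure
  set ρ := min τ (r / 4) with hρdef
  have hρ : 0 < ρ := by positivity
  have hρr : ρ ≤ r / 4 := min_le_right _ _
  have hρτ : ρ ≤ τ := min_le_left _ _
  set δ := min τ (ρ * η) with hδdef
  have hδ : 0 < δ := by positivity
  set K : Set E := {k | ‖k‖ ≤ ρ ∧ ‖Q k‖ ≤ τ ∧ ∀ w, ‖w‖ ≤ r → G w ≤ G k + ⟪Q k, w - k⟫} with hK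
  have hlip : ∀ k ∈ K, ∀ w, ‖w‖ ≤ r / 3 → ‖Q w - Q k‖ ≤ C * ‖w - k‖ := fun k hk w hw =>
    hQ.norm_sub_le hr (by linarith [hk.1]) hw hk.2.2
  have hlipK : LipschitzOnWith C.toNNReal Q K := by
    refine LipschitzOnWith.of_dist_le_mul fun x hx y hy => ?_
    rw [dist_eq_norm, dist_eq_norm, Real.coe_toNNReal _ hC]
    exact hlip y hy x (by linarith [hx.1])
  have himage : ball (0 : E) δ ⊆ Q '' K := by
    intro p hp
    rw [mem_ball_zero_iff] at hp
    obtain ⟨z, hz, hzmax⟩ := (isCompact_closedBall (0 : E) r).exists_isMaxOn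
      ⟨0, mem_closedBall_self hr.le⟩
      (by fun_prop : ContinuousOn (fun w => G w - ⟪p, w⟫) (closedBall 0 r))
    rw [mem_closedBall_zero_iff] at hz
    have hz0 : G 0 ≤ G z - ⟪p, z⟫ := by
      have := hzmax (mem_closedBall_self hr.le : (0 : E) ∈ closedBall 0 r)
      simpa using this
    have hzle : ∀ w, ‖w‖ ≤ r → G w ≤ G z + ⟪p, w - z⟫ := fun w hw => by
      have : G w - ⟪p, w⟫ ≤ G z - ⟪p, z⟫ := hzmax (mem_closedBall_zero_iff.2 hw)
      rw [inner_sub_right]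
      linarith
    have hzρ : ‖z‖ ≤ ρ := by
      have h1 := hmax z hz
      have h2 := abs_le.1 (abs_real_inner_le_norm p z)
      have h3 : η * ‖z‖ ^ 2 ≤ ρ * η * ‖z‖ := by
        have : ‖p‖ * ‖z‖ ≤ ρ * η * ‖z‖ := by
          gcongr
          exact hp.le.trans (min_le_right _ _)
        linarith
      by_contra hcon
      push Not at hcon
      have hz0 : 0 < ‖z‖ := hρ.trans hcon
      have : ρ * η * ‖z‖ < η * ‖z‖ ^ 2 := by
        have := mul_lt_mul_of_pos_left hcon (mul_pos hη hz0)
        nlinarith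
      linarith
    have hQz : Q z = p := by
      refine hQ.eq_of_eventually_le ?_
      filter_upwards [ball_mem_nhds (0 : E) (by positivity : 0 < r / 2)] with e he
      rw [mem_ball_zero_iff] at he
      have := hzle (z + e) ((norm_add_le _ _).trans (by linarith))
      rwa [add_sub_cancel_left] at this
    refine ⟨z, ⟨hzρ, ?_, ?_⟩, hQz⟩
    · rw [hQz]
      exact hp.le.trans (min_le_left _ _)
    · rwa [hQz]
  have hμK : μ K ≠ 0 := by
    intro h0
    have h1 := hlipK.hausdorffMeasure_image_le (d := (Module.finrank ℝ E : ℝ)) (by positivity)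
    rw [← hμ, h0, mul_zero] at h1
    have h2 : μ (ball (0 : E) δ) ≤ 0 := (measure_mono himage).trans h1
    exact absurd h2 (not_le.2 (measure_ball_pos μ 0 hδ))
  obtain ⟨z, hzK, hzd, hzdense⟩ : ∃ z ∈ K, DifferentiableWithinAt ℝ Q K z ∧
      ∀ θ > 0, ∀ᶠ h in 𝓝[≠] (0 : E), ∃ k ∈ K, ‖k - (z + h)‖ ≤ θ * ‖h‖ := by
    by_contra hcon
    have hdiff := ae_restrict_of_ae (s := K) (hlipK.ae_differentiableWithinAt_of_mem (μ := μ))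
    have hae := hdiff.and (exists_mem_near_of_density μ K)
    rw [ae_iff, Measure.restrict_apply_superset] at hae
    · exact hμK hae
    · exact fun z hz hgood => hcon ⟨z, hz, hgood.1 hz, hgood.2⟩
  have hFD : HasFDerivAt Q (fderivWithin ℝ Q K z) z :=
    hasFDerivAt_of_hasFDerivWithinAt_of_dense (r := r / 12) (by positivity) hC
      hzd.hasFDerivWithinAt
      (fun k hk w hw => hlip k hk w (by
        have := norm_add_le (w - z) z
        rw [sub_add_cancel] at this
        linarith [hzK.1])) hzdense
  have hexp := fun θ (hθ : 0 < θ) => hQ.expansion_of_hasFDerivAt hFD hθ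
  refine ⟨z, fderivWithin ℝ Q K z, hzK.1.trans hρτ, hzK.2.1, fun h => ?_, hexp⟩
  set D := fderivWithin ℝ Q K z
  by_contra hcon
  push Not at hcon
  have hh : 0 < ‖h‖ := by
    rw [norm_pos_iff]
    rintro rfl
    simp at hcon
  have h1 := hexp (⟪D h, h⟫ / (4 * ‖h‖ ^ 2)) (by positivity)
  have hc : Tendsto (fun t : ℝ => t • h) (𝓝[>] 0) (𝓝 (0 : E)) := by
    have : Tendsto (fun t : ℝ => t • h) (𝓝 0) (𝓝 ((0 : ℝ) • h)) :=
      (continuous_id.smul continuous_const).tendsto 0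
    rw [zero_smul] at this
    exact this.mono_left nhdsWithin_le_nhds
  obtain ⟨t, ht1, ht2, htpos⟩ := ((hc.eventually h1).and
    ((hc.eventually (ball_mem_nhds (0 : E) (by positivity : 0 < r / 2))).and
      self_mem_nhdsWithin)).exists
  have ht0 : 0 < t := htpos
  rw [dist_zero_right] at ht2
  have h2 := hzK.2.2 (z + t • h) ((norm_add_le _ _).trans (by linarith [hzK.1]))
  rw [add_sub_cancel_left] at h2
  have h3 := (abs_le.1 ht1).1
  rw [inner_smul_right] at h2
  simp only [map_smul, inner_smul_left, inner_smul_right, norm_smul, mul_pow, Real.norm_eq_abs,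
    sq_abs, conj_trivial] at h3
  have h4 : ⟪D h, h⟫ / (4 * ‖h‖ ^ 2) * (t ^ 2 * ‖h‖ ^ 2) = t ^ 2 * ⟪D h, h⟫ / 4 := by
    field_simp
  rw [h4] at h3
  have h5 : 0 < t ^ 2 * ⟪D h, h⟫ := by positivity
  nlinarith

end SecondOrder

section Doubling

variable {E : Type*} [NormedAddCommGroup E] [InnerProductSpace ℝ E]

theorem IsSemiconvexWith.exists_expansion_of_le_quadratic [FiniteDimensional ℝ E] {C : ℝ}
    {W : E → ℝ} {Q : E → E} (hQ : IsSemiconvexWith C W Q) (hC : 0 ≤ C) (hW : Continuous W)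
    {S : E →L[ℝ] E} (hS : ∀ v w, ⟪S v, w⟫ = ⟪S w, v⟫) {p : E} {r : ℝ} (hr : 0 < r)
    (hmax : ∀ w, ‖w‖ ≤ r → W w ≤ W 0 + ⟪p, w⟫ + ⟪S w, w⟫ / 2) {τ : ℝ} (hτ : 0 < τ) :
    ∃ z : E, ∃ D : E →L[ℝ] E, ‖z‖ ≤ τ ∧ ‖Q z - p‖ ≤ τ ∧
      (∀ h, ⟪D h, h⟫ ≤ ⟪S h, h⟫ + τ * ‖h‖ ^ 2) ∧
      ∀ θ > 0, ∀ᶠ h in 𝓝 (0 : E), |W (z + h) - W z - ⟪Q z, h⟫ - ⟪D h, h⟫ / 2| ≤ θ * ‖h‖ ^ 2 := by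
  set G : E → ℝ := fun w => W w - ⟪p, w⟫ - ⟪S w, w⟫ / 2 - τ / 2 * ‖w‖ ^ 2 with hGdef
  set QG : E → E := fun w => Q w - p - S w - τ • w with hQGdef
  have hsq : ∀ w e : E, ‖w + e‖ ^ 2 = ‖w‖ ^ 2 + 2 * ⟪w, e⟫ + ‖e‖ ^ 2 := fun w e =>
    norm_add_sq_real w e
  have hSq : ∀ w e : E, ⟪S (w + e), w + e⟫ = ⟪S w, w⟫ + 2 * ⟪S w, e⟫ + ⟪S e, e⟫ := fun w e => by
    rw [map_add, inner_add_left, inner_add_right, inner_add_right, hS e w]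
    ring
  have hQin : ∀ w e : E, ⟪QG w, e⟫ = ⟪Q w, e⟫ - ⟪p, e⟫ - ⟪S w, e⟫ - τ * ⟪w, e⟫ := fun w e => by
    simp only [hQGdef, inner_sub_left, inner_smul_left, conj_trivial]
  have hQG : IsSemiconvexWith (C + ‖S‖ + τ) G QG := by
    intro w e
    have h1 := hQ w e
    have h2 : ⟪S e, e⟫ ≤ ‖S‖ * ‖e‖ ^ 2 := by
      refine (real_inner_le_norm _ _).trans ?_
      nlinarith [S.le_opNorm e, norm_nonneg e]
    simp only [hGdef, hQin, hsq, hSq, inner_add_right]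
    nlinarith
  have hGc : Continuous G := by fun_prop
  set τ' := τ / (1 + ‖S‖ + τ) with hτ'
  have hden : 0 < 1 + ‖S‖ + τ := by positivity
  have hτ'0 : 0 < τ' := by positivity
  have hτ'1 : τ' * (1 + ‖S‖ + τ) = τ := by
    rw [hτ']
    field_simp
  have hτ'2 : τ' ≤ τ := by nlinarith [norm_nonneg S]
  obtain ⟨z, D, hz, hQz, hD, hexp⟩ := hQG.exists_expansion_near_max
    (by positivity) hGc (η := τ / 2) (r := r) (by positivity) hr (fun w hw => by
      have := hmax w hw
      simp only [hGdef, inner_zero_right, norm_zero]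
      nlinarith) hτ'0
  refine ⟨z, D + S + τ • ContinuousLinearMap.id ℝ E, hz.trans hτ'2, ?_, fun h => ?_, fun θ hθ => ?_⟩
  · have h1 : Q z - p = QG z + S z + τ • z := by
      simp only [hQGdef]
      abel
    rw [h1]
    refine (norm_add₃_le).trans ?_
    have h2 : ‖S z‖ ≤ ‖S‖ * τ' := (S.le_opNorm z).trans (by gcongr)
    have h3 : ‖τ • z‖ ≤ τ * τ' := by
      rw [norm_smul, Real.norm_of_nonneg hτ.le]
      gcongr
    nlinarith
  · have := hD h
    simp only [_root_.add_apply, _root_.smul_apply,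
      ContinuousLinearMap.id_apply, inner_add_left, inner_smul_left, conj_trivial,
      real_inner_self_eq_norm_sq]
    linarith
  · filter_upwards [hexp θ hθ] with h hh
    refine le_trans (le_of_eq ?_) hh
    congr 1
    simp only [hGdef, hQin, hsq, hSq, inner_add_right, _root_.add_apply,
      _root_.smul_apply,
      ContinuousLinearMap.id_apply, inner_add_left, inner_smul_left, conj_trivial,
      real_inner_self_eq_norm_sq]
    ring

theorem IsSemiconvexWith.continuous {C : ℝ} {U : E → ℝ} {Q : E → E}
    (hQ : IsSemiconvexWith C U Q) {a b : ℝ} (hb : ∀ x, ‖Q x‖ ≤ a + b * ‖x‖) (hb0 : 0 ≤ b) :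
    Continuous U := by
  rw [continuous_iff_continuousAt]
  intro x
  have key : ∀ᶠ y in 𝓝 x, dist (U y) (U x) ≤
      (a + b * (‖x‖ + 1)) * ‖y - x‖ + |C| / 2 * ‖y - x‖ ^ 2 := by
    filter_upwards [ball_mem_nhds x one_pos] with y hy
    rw [mem_ball, dist_eq_norm] at hy
    have hynorm : ‖y‖ ≤ ‖x‖ + 1 := by
      have := norm_add_le x (y - x)
      rw [add_sub_cancel] at this
      linarith
    have h1 := hQ x (y - x)
    have h2 := hQ y (x - y)
    rw [add_sub_cancel] at h1 h2
    have h3 := (abs_le.1 (abs_real_inner_le_norm (Q x) (y - x))).1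
    have h4 := (abs_le.1 (abs_real_inner_le_norm (Q y) (x - y))).1
    rw [norm_sub_rev x y] at h2 h4
    have h5 : ‖Q x‖ ≤ a + b * (‖x‖ + 1) := (hb x).trans (by nlinarith)
    have h6 : ‖Q y‖ ≤ a + b * (‖x‖ + 1) := (hb y).trans (by nlinarith)
    have h7 : C / 2 * ‖y - x‖ ^ 2 ≤ |C| / 2 * ‖y - x‖ ^ 2 := by
      gcongr
      exact le_abs_self C
    have h8 := mul_le_mul_of_nonneg_right h5 (norm_nonneg (y - x))
    have h9 := mul_le_mul_of_nonneg_right h6 (norm_nonneg (y - x))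
    rw [Real.dist_eq, abs_le]
    constructor <;> linarith
  refine tendsto_iff_dist_tendsto_zero.2 (squeeze_zero' (Eventually.of_forall fun _ => dist_nonneg)
    key ?_)
  have : Tendsto (fun y => (a + b * (‖x‖ + 1)) * ‖y - x‖ + |C| / 2 * ‖y - x‖ ^ 2) (𝓝 x)
      (𝓝 ((a + b * (‖x‖ + 1)) * ‖x - x‖ + |C| / 2 * ‖x - x‖ ^ 2)) :=
    (by fun_prop : Continuous fun y =>
      (a + b * (‖x‖ + 1)) * ‖y - x‖ + |C| / 2 * ‖y - x‖ ^ 2).tendsto x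
  simpa using this

/-- Sup-convolution of a continuous function on a compact set, together with a maximizer. -/
theorem exists_supConvolution {K : Set E} (hK : IsCompact K) (hne : K.Nonempty) {u : E → ℝ}
    (hu : ContinuousOn u K) {δ : ℝ} (hδ : 0 < δ) :
    ∃ U : E → ℝ, ∃ s : E → E, (∀ x, s x ∈ K) ∧ (∀ x, U x = u (s x) - ‖x - s x‖ ^ 2 / (2 * δ)) ∧
      (∀ x, ∀ y ∈ K, u y - ‖x - y‖ ^ 2 / (2 * δ) ≤ U x) ∧
      IsSemiconvexWith (1 / δ) U (fun x => (1 / δ) • (s x - x)) ∧ Continuous U := by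
  have h1 : ∀ x : E, ∃ s ∈ K, ∀ y ∈ K,
      u y - ‖x - y‖ ^ 2 / (2 * δ) ≤ u s - ‖x - s‖ ^ 2 / (2 * δ) := fun x => by
    obtain ⟨s, hs, hmax⟩ := hK.exists_isMaxOn hne
      (by fun_prop : ContinuousOn (fun y => u y - ‖x - y‖ ^ 2 / (2 * δ)) K)
    exact ⟨s, hs, fun y hy => hmax hy⟩
  choose s hsK hs using h1
  have hsemi : IsSemiconvexWith (1 / δ) (fun x => u (s x) - ‖x - s x‖ ^ 2 / (2 * δ))
      (fun x => (1 / δ) • (s x - x)) := by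
    intro w e
    have h2 := hs (w + e) (s w) (hsK w)
    have h3 : ‖w + e - s w‖ ^ 2 = ‖w - s w‖ ^ 2 - 2 * ⟪s w - w, e⟫ + ‖e‖ ^ 2 := by
      rw [show w + e - s w = e - (s w - w) by abel, norm_sub_sq_real, norm_sub_rev w,
        real_inner_comm]
      ring
    rw [h3] at h2
    refine le_trans (le_of_eq ?_) h2
    simp only [inner_smul_left, conj_trivial]
    field_simp
    ring
  refine ⟨_, s, hsK, fun x => rfl, fun x y hy => hs x y hy, hsemi, ?_⟩
  obtain ⟨B, hB⟩ := hK.isBounded.exists_norm_le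
  refine hsemi.continuous (a := 1 / δ * B) (b := 1 / δ) (fun x => ?_) (by positivity)
  rw [norm_smul, Real.norm_of_nonneg (by positivity), ← mul_add]
  gcongr
  exact (norm_sub_le _ _).trans (by linarith [hB _ (hsK x)])

end Doubling

/-- The symmetric matrix of the quadratic form `h ↦ ⟪T h, h⟫`. -/
def symMat {n : ℕ} (T : Euc n →L[ℝ] Euc n) : Matrix (Fin n) (Fin n) ℝ :=
  fun i j => (⟪T (EuclideanSpace.single i 1), EuclideanSpace.single j 1⟫ +
    ⟪T (EuclideanSpace.single j 1), EuclideanSpace.single i 1⟫) / 2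

theorem symMat_isSymm {n : ℕ} (T : Euc n →L[ℝ] Euc n) : (symMat T).IsSymm := by
  ext i j
  simp [symMat, add_comm]

theorem symMat_sub {n : ℕ} (T S : Euc n →L[ℝ] Euc n) :
    symMat (T - S) = symMat T - symMat S := by
  ext i j
  simp only [symMat, Matrix.sub_apply, _root_.sub_apply, inner_sub_left]
  ring

theorem symMat_zero {n : ℕ} : symMat (0 : Euc n →L[ℝ] Euc n) = 0 := by
  ext i j
  simp [symMat]

theorem dotProduct_symMat_mulVec {n : ℕ} (T : Euc n →L[ℝ] Euc n) (ξ : Fin n → ℝ) :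
    ξ ⬝ᵥ (symMat T).mulVec ξ = ⟪T (WithLp.toLp 2 ξ), WithLp.toLp 2 ξ⟫ := by
  have h : (WithLp.toLp 2 ξ : Euc n) = ∑ i, ξ i • EuclideanSpace.single i (1 : ℝ) := by
    ext j
    simp [Finset.sum_apply, Pi.single_apply]
  have h1 : ⟪T (WithLp.toLp 2 ξ), WithLp.toLp 2 ξ⟫ = ∑ i, ∑ j, ξ i * (ξ j *
      ⟪T (EuclideanSpace.single i 1), EuclideanSpace.single j 1⟫) := by
    rw [h, map_sum, sum_inner]
    refine Finset.sum_congr rfl fun i _ => ?_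
    rw [inner_sum]
    refine Finset.sum_congr rfl fun j _ => ?_
    rw [map_smul, real_inner_smul_left, real_inner_smul_right]
  have h2 := h1
  rw [Finset.sum_comm] at h2
  have h3 : ξ ⬝ᵥ (symMat T).mulVec ξ = (⟪T (WithLp.toLp 2 ξ), WithLp.toLp 2 ξ⟫ +
      ⟪T (WithLp.toLp 2 ξ), WithLp.toLp 2 ξ⟫) / 2 := by
    nth_rewrite 1 [h1]
    rw [h2, ← Finset.sum_add_distrib, Finset.sum_div]
    simp only [dotProduct, mulVec]
    refine Finset.sum_congr rfl fun i _ => ?_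
    rw [← Finset.sum_add_distrib, Finset.sum_div, Finset.mul_sum]
    refine Finset.sum_congr rfl fun j _ => ?_
    simp only [symMat]
    ring
  rw [h3]
  ring

theorem trace_mul_le_of_mem_ellMat {n : ℕ} {lam Lam μ ν : ℝ} (hlam : 0 ≤ lam)
    {A N : Matrix (Fin n) (Fin n) ℝ} (hA : A ∈ EllMat n lam Lam) (hN : N.IsSymm) (hμ : 0 ≤ μ)
    (hle : ∀ ξ : Fin n → ℝ, ξ ⬝ᵥ N.mulVec ξ ≤ μ * (ξ ⬝ᵥ ξ)) {e : Fin n → ℝ} (he : e ⬝ᵥ e = 1)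
    (hν : e ⬝ᵥ N.mulVec e ≤ -ν) : (A * N).trace ≤ n * Lam * μ - lam * ν := by
  set B : Matrix (Fin n) (Fin n) ℝ := μ • 1 - N with hB
  have hqB : ∀ ξ : Fin n → ℝ, ξ ⬝ᵥ B.mulVec ξ = μ * (ξ ⬝ᵥ ξ) - ξ ⬝ᵥ N.mulVec ξ := fun ξ => by
    rw [hB, sub_mulVec, dotProduct_sub, smul_mulVec, one_mulVec, dotProduct_smul, smul_eq_mul]
  have hpsd : B.PosSemidef := by
    rw [posSemidef_iff_dotProduct_mulVec]
    refine ⟨?_, fun x => ?_⟩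
    · rw [Matrix.IsHermitian, conjTranspose_eq_transpose_of_trivial, hB, transpose_sub, hN.eq,
        transpose_smul, transpose_one]
    · rw [star_trivial, hqB]
      linarith [hle x]
  obtain ⟨m, v, hv⟩ := Matrix.posSemidef_iff_eq_sum_vecMulVec.1 hpsd
  simp only [star_trivial] at hv
  have htrB : B.trace = ∑ k, v k ⬝ᵥ v k := by
    rw [hv, trace_sum]
    simp [trace_vecMulVec]
  have htrAB : (A * B).trace = ∑ k, v k ⬝ᵥ A.mulVec (v k) := by
    rw [hv, Finset.mul_sum, trace_sum]
    refine Finset.sum_congr rfl fun k _ => ?_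
    rw [mul_vecMulVec, trace_vecMulVec, dotProduct_comm]
  have h1 : lam * B.trace ≤ (A * B).trace := by
    rw [htrB, htrAB, Finset.mul_sum]
    exact Finset.sum_le_sum fun k _ => (hA.2 (v k)).1
  have h2 : e ⬝ᵥ B.mulVec e ≤ B.trace := by
    rw [htrB, hv, sum_mulVec, dotProduct_sum]
    refine Finset.sum_le_sum fun k _ => ?_
    rw [vecMulVec_mulVec, dotProduct_smul]
    have := Finset.sum_mul_sq_le_sq_mul_sq Finset.univ e (v k)
    simp only [dotProduct] at he ⊢
    simp only [← sq] at he ⊢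
    rw [he, one_mul] at this
    calc _ = (∑ i, e i * v k i) ^ 2 := by
          simp [sq, mul_comm]
      _ ≤ _ := this
  have h3 : A.trace ≤ n * Lam := by
    have : ∀ i, A i i ≤ Lam := fun i => by
      have := (hA.2 (Pi.single i 1)).2
      simpa using this
    calc A.trace = ∑ i, A i i := rfl
      _ ≤ ∑ _i : Fin n, Lam := Finset.sum_le_sum fun i _ => this i
      _ = n * Lam := by simp
  have h4 : (A * N).trace = μ * A.trace - (A * B).trace := by
    have : N = μ • 1 - B := by rw [hB]; abel
    rw [this, mul_sub, trace_sub, mul_smul_comm, mul_one, trace_smul, smul_eq_mul]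
  rw [hqB, he] at h2
  have h5 : lam * (μ + ν) ≤ lam * B.trace := mul_le_mul_of_nonneg_left (by linarith) hlam
  have h6 := mul_le_mul_of_nonneg_left h3 hμ
  have h7 := mul_nonneg hlam hμ
  rw [h4]
  nlinarith

/-- Degenerate uniform ellipticity of an operator acting on quadratic forms `h ↦ ⟪T h, h⟫`. -/
def IsEllipticForm {E : Type*} [NormedAddCommGroup E] [InnerProductSpace ℝ E]
    (lam K : ℝ) (G : (E →L[ℝ] E) → ℝ) : Prop :=
  ∀ (X Y : E →L[ℝ] E) (μ ν : ℝ) (e : E), 0 ≤ μ → ‖e‖ = 1 →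
    (∀ h, ⟪X h, h⟫ - ⟪Y h, h⟫ ≤ μ * ‖h‖ ^ 2) → ⟪X e, e⟫ - ⟪Y e, e⟫ ≤ -ν →
    G X - G Y ≤ K * μ - lam * ν

theorem IsUniformlyElliptic.isEllipticForm {n : ℕ} {lam Lam : ℝ} (hlam : 0 ≤ lam)
    (hle : lam ≤ Lam) {F : Matrix (Fin n) (Fin n) ℝ → ℝ} (hF : IsUniformlyElliptic n lam Lam F) :
    IsEllipticForm lam (n * Lam) (fun T : Euc n →L[ℝ] Euc n => F (symMat T)) := by
  intro X Y μ ν e hμ he h1 h2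
  refine (hF _ _ (symMat_isSymm X) (symMat_isSymm Y)).2.trans ?_
  have hne : (EllMat n lam Lam).Nonempty := by
    refine ⟨lam • 1, ?_, fun ξ => ?_⟩
    · rw [Matrix.IsSymm, transpose_smul, transpose_one]
    · have : 0 ≤ ξ ⬝ᵥ ξ := by
        simpa using dotProduct_star_self_nonneg ξ
      rw [smul_mulVec, one_mulVec, dotProduct_smul, smul_eq_mul]
      exact ⟨le_rfl, mul_le_mul_of_nonneg_right hle this⟩
  refine csSup_le (hne.image _) ?_
  rintro _ ⟨A, hA, rfl⟩
  have hsq : ∀ ξ : Fin n → ℝ, ξ ⬝ᵥ ξ = ‖(WithLp.toLp 2 ξ : Euc n)‖ ^ 2 := fun ξ => by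
    rw [EuclideanSpace.norm_sq_eq]
    simp [dotProduct, sq]
  refine trace_mul_le_of_mem_ellMat hlam hA
    (by rw [← symMat_sub]; exact symMat_isSymm _) hμ (fun ξ => ?_) (e := WithLp.ofLp e) ?_ ?_
  · rw [← symMat_sub, dotProduct_symMat_mulVec, _root_.sub_apply, inner_sub_left, hsq]
    exact h1 _
  · rw [hsq, WithLp.toLp_ofLp, he, one_pow]
  · rw [← symMat_sub, dotProduct_symMat_mulVec, _root_.sub_apply, inner_sub_left,
      WithLp.toLp_ofLp]
    exact h2

/-- `(p, X)` is a second-order superjet of `u` at `x`. -/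
def UpperJet {E : Type*} [NormedAddCommGroup E] [InnerProductSpace ℝ E] (u : E → ℝ) (x p : E)
    (X : E →L[ℝ] E) : Prop :=
  ∀ θ > 0, ∀ᶠ h in 𝓝 (0 : E), u (x + h) ≤ u x + ⟪p, h⟫ + ⟪X h, h⟫ / 2 + θ * ‖h‖ ^ 2

/-- `(p, X)` is a second-order subjet of `u` at `x`. -/
def LowerJet {E : Type*} [NormedAddCommGroup E] [InnerProductSpace ℝ E] (u : E → ℝ) (x p : E)
    (X : E →L[ℝ] E) : Prop :=
  ∀ θ > 0, ∀ᶠ h in 𝓝 (0 : E), u x + ⟪p, h⟫ + ⟪X h, h⟫ / 2 - θ * ‖h‖ ^ 2 ≤ u (x + h)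

section QuadraticTest

variable {E : Type*} [NormedAddCommGroup E] [InnerProductSpace ℝ E]

theorem contDiff_quadratic (x p : E) (T : E →L[ℝ] E) :
    ContDiff ℝ 2 (fun y => ⟪p, y - x⟫ + ⟪T (y - x), y - x⟫ / 2) := by
  have h1 : ContDiff ℝ 2 (fun y : E => y - x) := contDiff_id.sub contDiff_const
  exact (contDiff_const.inner ℝ h1).add (((T.contDiff.comp h1).inner ℝ h1).div_const 2)

/-- The symmetric bilinear form of `h ↦ ⟪T h, h⟫`. -/
def symForm (T : E →L[ℝ] E) : E →L[ℝ] E →L[ℝ] ℝ :=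
  (1 / 2 : ℝ) • (isBoundedBilinearMap_inner.toContinuousLinearMap.comp T +
    (isBoundedBilinearMap_inner.toContinuousLinearMap.comp T).flip)

theorem symForm_apply (T : E →L[ℝ] E) (v w : E) :
    symForm T v w = (⟪T v, w⟫ + ⟪T w, v⟫) / 2 := by
  simp only [symForm, _root_.smul_apply, _root_.add_apply, ContinuousLinearMap.comp_apply,
    ContinuousLinearMap.flip_apply, IsBoundedBilinearMap.toContinuousLinearMap_apply, smul_eq_mul]
  ring

theorem hasFDerivAt_quadratic (x p : E) (T : E →L[ℝ] E) (y : E) :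
    HasFDerivAt (fun y => ⟪p, y - x⟫ + ⟪T (y - x), y - x⟫ / 2)
      (innerSL ℝ p + symForm T (y - x)) y := by
  have h1 : HasFDerivAt (fun y : E => y - x) (ContinuousLinearMap.id ℝ E) y :=
    (hasFDerivAt_id y).sub_const x
  have h2 := (T.hasFDerivAt (x := y - x)).comp y h1
  have h3 := ((hasFDerivAt_const p y).inner ℝ h1).add ((h2.inner ℝ h1).mul_const (1 / 2))
  refine (h3.congr_fderiv ?_).congr_of_eventuallyEq ?_
  · ext v
    simp only [symForm_apply, map_sub, _root_.sub_apply, inner_sub_left, inner_sub_right, _root_.add_apply,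
      _root_.smul_apply, ContinuousLinearMap.comp_apply, ContinuousLinearMap.prod_apply,
      fderivInnerCLM_apply, ContinuousLinearMap.id_apply, _root_.zero_apply, inner_zero_left,
      smul_eq_mul, innerSL_apply_apply, Function.comp_apply]
    ring
  · refine Eventually.of_forall fun z => ?_
    simp [div_eq_mul_inv]

theorem fderiv_quadratic (x p : E) (T : E →L[ℝ] E) :
    fderiv ℝ (fun y => ⟪p, y - x⟫ + ⟪T (y - x), y - x⟫ / 2) =
      fun y => innerSL ℝ p + symForm T (y - x) :=
  funext fun y => (hasFDerivAt_quadratic x p T y).fderiv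

theorem fderiv_fderiv_quadratic (x p : E) (T : E →L[ℝ] E) (y : E) :
    fderiv ℝ (fderiv ℝ (fun y => ⟪p, y - x⟫ + ⟪T (y - x), y - x⟫ / 2)) y = symForm T := by
  rw [fderiv_quadratic]
  have h1 : HasFDerivAt (fun y : E => y - x) (ContinuousLinearMap.id ℝ E) y :=
    (hasFDerivAt_id y).sub_const x
  have h2 := ((symForm T).hasFDerivAt (x := y - x)).comp y h1
  exact (h2.const_add (innerSL ℝ p)).fderiv

end QuadraticTest

theorem hess_quadratic {n : ℕ} (x p : Euc n) (T : Euc n →L[ℝ] Euc n) :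
    hess (fun y => ⟪p, y - x⟫ + ⟪T (y - x), y - x⟫ / 2) x = symMat T := by
  ext i j
  rw [hess, iteratedFDeriv_two_apply, fderiv_fderiv_quadratic, symForm_apply]
  rfl

section ViscosityJets

variable {E : Type*} [NormedAddCommGroup E] [InnerProductSpace ℝ E]

theorem inner_add_smul_id (X : E →L[ℝ] E) (c : ℝ) (h : E) :
    ⟪(X + c • ContinuousLinearMap.id ℝ E) h, h⟫ = ⟪X h, h⟫ + c * ‖h‖ ^ 2 := by
  simp [inner_add_left, real_inner_smul_left]

theorem IsEllipticForm.sub_le_of_add_smul_id {lam K : ℝ} {G : (E →L[ℝ] E) → ℝ}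
    (hG : IsEllipticForm lam K G) {e : E} (he : ‖e‖ = 1) (X : E →L[ℝ] E) {c : ℝ} (hc : 0 ≤ c) :
    G (X + c • ContinuousLinearMap.id ℝ E) - G X ≤ (K + lam) * c := by
  have := hG (X + c • ContinuousLinearMap.id ℝ E) X c (-c) e hc he
    (fun h => by rw [inner_add_smul_id]; linarith)
    (by rw [inner_add_smul_id, he]; linarith)
  linarith

theorem le_of_forall_pos_le_add_mul {a b c : ℝ} (h : ∀ θ > 0, a ≤ b + c * θ) : a ≤ b := by
  have h1 : Tendsto (fun θ : ℝ => b + c * θ) (𝓝[>] 0) (𝓝 b) := by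
    have : Tendsto (fun θ : ℝ => b + c * θ) (𝓝 0) (𝓝 (b + c * 0)) :=
      (continuous_const.add (continuous_const.mul continuous_id)).tendsto 0
    rw [mul_zero, add_zero] at this
    exact this.mono_left nhdsWithin_le_nhds
  exact ge_of_tendsto h1 (eventually_mem_nhdsWithin.mono fun θ hθ => h θ hθ)

end ViscosityJets

theorem eventually_add_of_eventually {E : Type*} [NormedAddCommGroup E] {P : E → Prop} {x : E}
    (h : ∀ᶠ h in 𝓝 (0 : E), P (x + h)) : ∀ᶠ y in 𝓝 x, P y := by
  have h1 : Tendsto (fun y => y - x) (𝓝 x) (𝓝 (0 : E)) := by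
    have : Tendsto (fun y : E => y - x) (𝓝 x) (𝓝 (x - x)) :=
      (continuous_id.sub continuous_const).tendsto x
    rwa [sub_self] at this
  filter_upwards [h1.eventually h] with y hy
  simpa using hy

theorem ViscSol.le_of_upperJet {n : ℕ} {lam K : ℝ} {F : Matrix (Fin n) (Fin n) ℝ → ℝ}
    (hF : IsEllipticForm lam K (fun T : Euc n →L[ℝ] Euc n => F (symMat T)))
    {f : Euc n → ℝ} {s : Set (Euc n)} {u : Euc n → ℝ} (hu : ViscSol (fun _ N => F N) f s u)
    {e : Euc n} (he : ‖e‖ = 1) {x : Euc n} (hx : x ∈ s) {p : Euc n} {X : Euc n →L[ℝ] Euc n}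
    (hX : UpperJet u x p X) : f x ≤ F (symMat X) := by
  refine le_of_forall_pos_le_add_mul (c := (K + lam) * 2) fun θ hθ => ?_
  have h1 := hu.1 x hx _ (contDiff_quadratic x p (X + (2 * θ) • ContinuousLinearMap.id ℝ (Euc n)))
    (eventually_add_of_eventually ((hX θ hθ).mono fun h hh => by
      simp only [add_sub_cancel_left, inner_add_smul_id, sub_self, inner_zero_right]
      linarith))
  rw [hess_quadratic] at h1
  have h2 := hF.sub_le_of_add_smul_id he X (c := 2 * θ) (by linarith)
  dsimp only at h1 h2
  linarith

theorem ViscSol.le_of_lowerJet {n : ℕ} {lam K : ℝ} {F : Matrix (Fin n) (Fin n) ℝ → ℝ}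
    (hF : IsEllipticForm lam K (fun T : Euc n →L[ℝ] Euc n => F (symMat T)))
    {f : Euc n → ℝ} {s : Set (Euc n)} {u : Euc n → ℝ} (hu : ViscSol (fun _ N => F N) f s u)
    {e : Euc n} (he : ‖e‖ = 1) {x : Euc n} (hx : x ∈ s) {p : Euc n} {X : Euc n →L[ℝ] Euc n}
    (hX : LowerJet u x p X) : F (symMat X) ≤ f x := by
  refine le_of_forall_pos_le_add_mul (c := (K + lam) * 2) fun θ hθ => ?_
  have h1 := hu.2 x hx _ (contDiff_quadratic x p (X + (-(2 * θ)) • ContinuousLinearMap.id ℝ (Euc n)))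
    (eventually_add_of_eventually ((hX θ hθ).mono fun h hh => by
      simp only [add_sub_cancel_left, inner_add_smul_id, sub_self, inner_zero_right]
      linarith))
  rw [hess_quadratic] at h1
  have h2 := hF.sub_le_of_add_smul_id he
    (X + (-(2 * θ)) • ContinuousLinearMap.id ℝ (Euc n)) (c := 2 * θ) (by linarith)
  rw [add_assoc, ← add_smul, neg_add_cancel, zero_smul, add_zero] at h2
  dsimp only at h1 h2
  linarith

section Doubling

variable {E : Type*} [NormedAddCommGroup E] [InnerProductSpace ℝ E]

theorem UpperJet.of_supConvolution {K : Set E} {u U : E → ℝ} {s : E → E} {δ : ℝ} {x q : E}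
    {X : E →L[ℝ] E} (hU : ∀ x, U x = u (s x) - ‖x - s x‖ ^ 2 / (2 * δ))
    (hle : ∀ x, ∀ y ∈ K, u y - ‖x - y‖ ^ 2 / (2 * δ) ≤ U x) (hx : K ∈ 𝓝 (s x))
    (h : UpperJet U x q X) : UpperJet u (s x) q X := by
  intro θ hθ
  have h1 : Tendsto (fun k => s x + k) (𝓝 (0 : E)) (𝓝 (s x)) := by
    have : Tendsto (fun k => s x + k) (𝓝 (0 : E)) (𝓝 (s x + 0)) :=
      (continuous_const.add continuous_id).tendsto 0
    rwa [add_zero] at this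
  filter_upwards [h θ hθ, h1.eventually hx] with k hk hkK
  have h2 := hle (x + k) _ hkK
  rw [add_sub_add_right_eq_sub] at h2
  rw [hU x] at hk
  linarith

theorem exists_jets_of_le_quadratic [FiniteDimensional ℝ E] {C : ℝ} {U₁ U₂ : E → ℝ} {Q₁ Q₂ : E → E}
    (h₁ : IsSemiconvexWith C U₁ Q₁) (h₂ : IsSemiconvexWith C U₂ Q₂) (hC : 0 ≤ C)
    (hc₁ : Continuous U₁) (hc₂ : Continuous U₂) {P : E →L[ℝ] E} (hP : ∀ v w, ⟪P v, w⟫ = ⟪P w, v⟫)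
    {c r : ℝ} (hr : 0 < r) {x₀ y₀ p₁ p₂ : E}
    (hmax : ∀ a b, ‖a‖ ≤ r → ‖b‖ ≤ r → U₁ (x₀ + a) + U₂ (y₀ + b) ≤ U₁ x₀ + U₂ y₀ + ⟪p₁, a⟫ +
      ⟪p₂, b⟫ + (⟪P (a - b), a - b⟫ + c * ‖a‖ ^ 2) / 2) {τ : ℝ} (hτ : 0 < τ) :
    ∃ (x y q₁ q₂ : E) (X₁ X₂ : E →L[ℝ] E), ‖x - x₀‖ ≤ τ ∧ ‖y - y₀‖ ≤ τ ∧ ‖q₁ - p₁‖ ≤ τ ∧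
      ‖q₂ - p₂‖ ≤ τ ∧ UpperJet U₁ x q₁ X₁ ∧ UpperJet U₂ y q₂ X₂ ∧
      ∀ a b, ⟪X₁ a, a⟫ + ⟪X₂ b, b⟫ ≤
        ⟪P (a - b), a - b⟫ + c * ‖a‖ ^ 2 + τ * (‖a‖ ^ 2 + ‖b‖ ^ 2) := by
  set i := WithLp.prodContinuousLinearEquiv 2 ℝ E E with hi
  have hin : ∀ v w : WithLp 2 (E × E), ⟪v, w⟫ = ⟪v.fst, w.fst⟫ + ⟪v.snd, w.snd⟫ :=
    fun v w => WithLp.prod_inner_apply v w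
  have hno : ∀ v : WithLp 2 (E × E), ‖v‖ ^ 2 = ‖v.fst‖ ^ 2 + ‖v.snd‖ ^ 2 :=
    fun v => WithLp.prod_norm_sq_eq_of_L2 v
  have hnf : ∀ v : WithLp 2 (E × E), ‖v.fst‖ ≤ ‖v‖ := fun v =>
    abs_le_of_sq_le_sq' (by nlinarith [hno v, sq_nonneg ‖v.snd‖]) (norm_nonneg _) |>.2
  have hns : ∀ v : WithLp 2 (E × E), ‖v.snd‖ ≤ ‖v‖ := fun v =>
    abs_le_of_sq_le_sq' (by nlinarith [hno v, sq_nonneg ‖v.fst‖]) (norm_nonneg _) |>.2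
  set df : E × E →L[ℝ] E := ContinuousLinearMap.fst ℝ E E - ContinuousLinearMap.snd ℝ E E with hdf
  set S : WithLp 2 (E × E) →L[ℝ] WithLp 2 (E × E) :=
    (i.symm : E × E →L[ℝ] WithLp 2 (E × E)).comp (((P.comp df + c • ContinuousLinearMap.fst ℝ E E).prod
      (-(P.comp df))).comp (i : WithLp 2 (E × E) →L[ℝ] E × E)) with hSdef
  have hSin : ∀ v w, ⟪S v, w⟫ = ⟪P (v.fst - v.snd), w.fst - w.snd⟫ + c * ⟪v.fst, w.fst⟫ := by
    intro v w
    have e1 : (S v).fst = P (v.fst - v.snd) + c • v.fst := rfl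
    have e2 : (S v).snd = -P (v.fst - v.snd) := rfl
    rw [hin, e1, e2, inner_add_left, inner_neg_left, inner_sub_right, real_inner_smul_left]
    ring
  set W : WithLp 2 (E × E) → ℝ := fun w => U₁ (x₀ + w.fst) + U₂ (y₀ + w.snd) with hWdef
  set Q : WithLp 2 (E × E) → WithLp 2 (E × E) :=
    fun w => WithLp.toLp 2 (Q₁ (x₀ + w.fst), Q₂ (y₀ + w.snd)) with hQdef
  have hsemi : IsSemiconvexWith C W Q := by
    intro w e
    have a1 := h₁ (x₀ + w.fst) e.fst
    have a2 := h₂ (y₀ + w.snd) e.snd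
    rw [hin, hno]
    change U₁ (x₀ + w.fst) + U₂ (y₀ + w.snd) + (⟪Q₁ (x₀ + w.fst), e.fst⟫ +
      ⟪Q₂ (y₀ + w.snd), e.snd⟫) - C / 2 * (‖e.fst‖ ^ 2 + ‖e.snd‖ ^ 2) ≤
      U₁ (x₀ + (w.fst + e.fst)) + U₂ (y₀ + (w.snd + e.snd))
    rw [← add_assoc x₀, ← add_assoc y₀]
    linarith
  have hcf : Continuous (fun w : WithLp 2 (E × E) => w.fst) := continuous_fst.comp i.continuous
  have hcs : Continuous (fun w : WithLp 2 (E × E) => w.snd) := continuous_snd.comp i.continuous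
  have hWc : Continuous W :=
    (hc₁.comp (continuous_const.add hcf)).add (hc₂.comp (continuous_const.add hcs))
  obtain ⟨z, D, hz, hQz, hD, hexp⟩ := hsemi.exists_expansion_of_le_quadratic hC hWc (S := S)
    (fun v w => by
      rw [hSin, hSin, hP, real_inner_comm v.fst w.fst]) (p := WithLp.toLp 2 (p₁, p₂)) hr
    (fun w hw => by
      rw [hSin, hin, real_inner_self_eq_norm_sq]
      have := hmax w.fst w.snd ((hnf w).trans hw) ((hns w).trans hw)
      change U₁ (x₀ + w.fst) + U₂ (y₀ + w.snd) ≤ U₁ (x₀ + 0) + U₂ (y₀ + 0) +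
        (⟪p₁, w.fst⟫ + ⟪p₂, w.snd⟫) + (_ + c * ‖w.fst‖ ^ 2) / 2
      rw [add_zero, add_zero]
      linarith) hτ
  set X₁ : E →L[ℝ] E := (ContinuousLinearMap.fst ℝ E E).comp
    (((i : WithLp 2 (E × E) →L[ℝ] E × E).comp (D.comp (i.symm : E × E →L[ℝ] WithLp 2 (E × E)))).comp
      (ContinuousLinearMap.inl ℝ E E)) with hX₁
  set X₂ : E →L[ℝ] E := (ContinuousLinearMap.snd ℝ E E).comp
    (((i : WithLp 2 (E × E) →L[ℝ] E × E).comp (D.comp (i.symm : E × E →L[ℝ] WithLp 2 (E × E)))).comp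
      (ContinuousLinearMap.inr ℝ E E)) with hX₂
  have hX₁q : ∀ a, ⟪X₁ a, a⟫ = ⟪D (WithLp.toLp 2 (a, 0)), WithLp.toLp 2 (a, 0)⟫ := fun a => by
    rw [hin]
    change _ = _ + ⟪_, (0 : E)⟫
    rw [inner_zero_right, add_zero]
    rfl
  have hX₂q : ∀ b, ⟪X₂ b, b⟫ = ⟪D (WithLp.toLp 2 (0, b)), WithLp.toLp 2 (0, b)⟫ := fun b => by
    rw [hin]
    change _ = ⟪_, (0 : E)⟫ + _
    rw [inner_zero_right, zero_add]
    rfl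
  have hn1 : ∀ a : E, ‖(WithLp.toLp 2 (a, (0 : E)))‖ ^ 2 = ‖a‖ ^ 2 := fun a => by
    rw [hno]; simp
  have hn2 : ∀ b : E, ‖(WithLp.toLp 2 ((0 : E), b))‖ ^ 2 = ‖b‖ ^ 2 := fun a => by
    rw [hno]; simp
  have ht1 : Tendsto (fun a : E => (WithLp.toLp 2 (a, (0 : E)))) (𝓝 0) (𝓝 0) := by
    have : Continuous (fun a : E => i.symm (a, (0 : E))) :=
      i.symm.continuous.comp (continuous_id.prodMk continuous_const)
    exact this.tendsto' 0 0 (map_zero i.symm)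
  have ht2 : Tendsto (fun b : E => (WithLp.toLp 2 ((0 : E), b))) (𝓝 0) (𝓝 0) := by
    have : Continuous (fun b : E => i.symm ((0 : E), b)) :=
      i.symm.continuous.comp (continuous_const.prodMk continuous_id)
    exact this.tendsto' 0 0 (map_zero i.symm)
  have hW1 : ∀ a, W (z + WithLp.toLp 2 (a, 0)) - W z = U₁ (x₀ + z.fst + a) - U₁ (x₀ + z.fst) :=
    fun a => by
      change U₁ (x₀ + (z.fst + a)) + U₂ (y₀ + (z.snd + 0)) -
        (U₁ (x₀ + z.fst) + U₂ (y₀ + z.snd)) = _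
      rw [← add_assoc, ← add_assoc, add_zero]
      ring
  have hW2 : ∀ b, W (z + WithLp.toLp 2 (0, b)) - W z = U₂ (y₀ + z.snd + b) - U₂ (y₀ + z.snd) :=
    fun b => by
      change U₁ (x₀ + (z.fst + 0)) + U₂ (y₀ + (z.snd + b)) -
        (U₁ (x₀ + z.fst) + U₂ (y₀ + z.snd)) = _
      rw [← add_assoc, ← add_assoc, add_zero]
      ring
  have hQ1 : ∀ a, ⟪Q z, WithLp.toLp 2 (a, 0)⟫ = ⟪Q₁ (x₀ + z.fst), a⟫ := fun a => by
    rw [hin]; simp [hQdef]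
  have hQ2 : ∀ b, ⟪Q z, WithLp.toLp 2 (0, b)⟫ = ⟪Q₂ (y₀ + z.snd), b⟫ := fun b => by
    rw [hin]; simp [hQdef]
  refine ⟨x₀ + z.fst, y₀ + z.snd, Q₁ (x₀ + z.fst), Q₂ (y₀ + z.snd), X₁, X₂, ?_, ?_, ?_, ?_, ?_, ?_, ?_⟩
  · rw [add_sub_cancel_left]; exact (hnf z).trans hz
  · rw [add_sub_cancel_left]; exact (hns z).trans hz
  · exact (hnf (Q z - WithLp.toLp 2 (p₁, p₂))).trans hQz
  · exact (hns (Q z - WithLp.toLp 2 (p₁, p₂))).trans hQz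
  · intro θ hθ
    filter_upwards [ht1.eventually (hexp θ hθ)] with a ha
    have := (abs_le.1 ha).2
    rw [hW1, hQ1, ← hX₁q, hn1] at this
    linarith
  · intro θ hθ
    filter_upwards [ht2.eventually (hexp θ hθ)] with b hb
    have := (abs_le.1 hb).2
    rw [hW2, hQ2, ← hX₂q, hn2] at this
    linarith
  · intro a b
    set w : WithLp 2 (E × E) := WithLp.toLp 2 (a, b) with hw
    have h1 := hD w
    rw [hSin, real_inner_self_eq_norm_sq, hno] at h1
    refine le_trans ?_ h1
    refine le_of_forall_pos_le_add_mul (c := 4 * (‖a‖ ^ 2 + ‖b‖ ^ 2)) fun θ hθ => ?_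
    have hs : ∀ v : WithLp 2 (E × E), Tendsto (fun t : ℝ => t • v) (𝓝[>] 0) (𝓝 0) := fun v => by
      have : Tendsto (fun t : ℝ => t • v) (𝓝 0) (𝓝 ((0 : ℝ) • v)) :=
        (continuous_id.smul continuous_const).tendsto 0
      rw [zero_smul] at this
      exact this.mono_left nhdsWithin_le_nhds
    have hev : ∀ᶠ t : ℝ in 𝓝[>] 0, 0 < t := eventually_mem_nhdsWithin
    obtain ⟨t, ht, e1, e2, e3⟩ := (hev.and (((hs w).eventually (hexp θ hθ)).and
      (((hs (WithLp.toLp 2 (a, 0))).eventually (hexp θ hθ)).and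
        ((hs (WithLp.toLp 2 (0, b))).eventually (hexp θ hθ))))).exists
    have k1 : t • (WithLp.toLp 2 (a, (0 : E))) = WithLp.toLp 2 (t • a, (0 : E)) := by
      rw [← WithLp.toLp_smul, Prod.smul_mk, smul_zero]
    have k2 : t • (WithLp.toLp 2 ((0 : E), b)) = WithLp.toLp 2 ((0 : E), t • b) := by
      rw [← WithLp.toLp_smul, Prod.smul_mk, smul_zero]
    have k3 : W (z + t • w) - W z = (U₁ (x₀ + z.fst + t • a) - U₁ (x₀ + z.fst)) +
        (U₂ (y₀ + z.snd + t • b) - U₂ (y₀ + z.snd)) := by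
      change U₁ (x₀ + (z.fst + t • a)) + U₂ (y₀ + (z.snd + t • b)) -
        (U₁ (x₀ + z.fst) + U₂ (y₀ + z.snd)) = _
      rw [← add_assoc, ← add_assoc]
      ring
    have k4 : ⟪Q z, t • w⟫ = ⟪Q₁ (x₀ + z.fst), t • a⟫ + ⟪Q₂ (y₀ + z.snd), t • b⟫ := hin _ _
    have k5 : ⟪D (t • w), t • w⟫ = t ^ 2 * ⟪D w, w⟫ := by
      rw [map_smul, real_inner_smul_left, real_inner_smul_right]; ring
    have k6 : ⟪X₁ (t • a), t • a⟫ = t ^ 2 * ⟪X₁ a, a⟫ := by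
      rw [map_smul, real_inner_smul_left, real_inner_smul_right]; ring
    have k7 : ⟪X₂ (t • b), t • b⟫ = t ^ 2 * ⟪X₂ b, b⟫ := by
      rw [map_smul, real_inner_smul_left, real_inner_smul_right]; ring
    have k8 : ‖t • w‖ ^ 2 = t ^ 2 * (‖a‖ ^ 2 + ‖b‖ ^ 2) := by
      rw [norm_smul, mul_pow, hno, Real.norm_eq_abs, sq_abs]
      rfl
    have k9 : ∀ a : E, ‖t • a‖ ^ 2 = t ^ 2 * ‖a‖ ^ 2 := fun a => by
      rw [norm_smul, mul_pow, Real.norm_eq_abs, sq_abs]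
    rw [k3, k4, k5, k8] at e1
    rw [k1, hW1, hQ1, ← hX₁q, hn1, k6, k9] at e2
    rw [k2, hW2, hQ2, ← hX₂q, hn2, k7, k9] at e3
    have e1' := (abs_le.1 e1).2
    have e2' := (abs_le.1 e2).1
    have e3' := (abs_le.1 e3).1
    have ht2 : 0 < t ^ 2 := by positivity
    refine le_of_mul_le_mul_left ?_ ht2
    linarith

end Doubling

theorem norm_sub_sq_le_of_supConvolution {E : Type*} [NormedAddCommGroup E] {K : Set E} {u U : E → ℝ} {s : E → E} {δ S : ℝ}
    (hδ : 0 < δ) (hs : ∀ x, s x ∈ K) (hU : ∀ x, U x = u (s x) - ‖x - s x‖ ^ 2 / (2 * δ))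
    (hle : ∀ x, ∀ y ∈ K, u y - ‖x - y‖ ^ 2 / (2 * δ) ≤ U x)
    (hS : ∀ x ∈ K, ∀ y ∈ K, u x - u y ≤ S) {x : E} (hx : x ∈ K) :
    ‖s x - x‖ ^ 2 ≤ 2 * δ * S := by
  have h1 := hle x x hx
  have h2 := hS _ (hs x) x hx
  rw [hU x, sub_self, norm_zero] at h1
  rw [norm_sub_rev]
  have : ‖x - s x‖ ^ 2 / (2 * δ) ≤ S := by
    have : (0 : ℝ) ^ 2 / (2 * δ) = 0 := by simp
    linarith
  rw [div_le_iff₀ (by positivity)] at this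
  linarith

section IshiiLions

variable {E : Type*} [NormedAddCommGroup E] [InnerProductSpace ℝ E]

theorem norm_add_le_of_norm_le_half {d : ℝ} (hd : 0 < d) {e h : E} (he : ‖e‖ = 1)
    (hh : ‖h‖ ≤ d / 2) :
    ‖d • e + h‖ ≤ d + ⟪e, h⟫ + (‖h‖ ^ 2 - ⟪e, h⟫ ^ 2) / d := by
  set s := ⟪e, h⟫ with hs
  have h1 : |s| ≤ ‖h‖ := by
    have := abs_real_inner_le_norm e h
    rwa [he, one_mul] at this
  have h2 : 0 ≤ ‖h‖ ^ 2 - s ^ 2 := by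
    have := sq_le_sq' (by linarith [neg_abs_le s, abs_nonneg s]) h1
    rw [sq_abs] at this
    linarith
  have h3 : d / 2 ≤ d + s := by linarith [neg_abs_le s]
  have h4 : 0 ≤ (‖h‖ ^ 2 - s ^ 2) / d := by positivity
  have h5 : ‖d • e + h‖ ^ 2 = d ^ 2 + 2 * d * s + ‖h‖ ^ 2 := by
    rw [norm_add_sq_real, norm_smul, he, real_inner_smul_left, Real.norm_of_nonneg hd.le]
    ring
  refine abs_le_of_sq_le_sq' ?_ (by linarith) |>.2
  rw [h5]
  have h6 : (‖h‖ ^ 2 - s ^ 2) / d * d = ‖h‖ ^ 2 - s ^ 2 := div_mul_cancel₀ _ hd.ne'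
  have h7 := mul_le_mul_of_nonneg_left h3 h4
  nlinarith [sq_nonneg ((‖h‖ ^ 2 - s ^ 2) / d)]

theorem UpperJet.neg {u : E → ℝ} {x p : E} {X : E →L[ℝ] E}
    (h : UpperJet (fun y => -u y) x p X) : LowerJet u x (-p) (-X) := by
  intro θ hθ
  filter_upwards [h θ hθ] with k hk
  simp only [inner_neg_left, _root_.neg_apply]
  linarith

/-- The quadratic part of the expansion of `‖w‖ - ‖w‖ ^ 2 / R` near `w = d • e`. -/
def coneForm (L R d : ℝ) (e : E) : E →L[ℝ] E :=
  (2 * L / d - 2 * L / R) • ContinuousLinearMap.id ℝ E -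
    (2 * L / d) • (innerSL ℝ e).smulRight e

theorem inner_coneForm (L R d : ℝ) (e v w : E) : ⟪coneForm L R d e v, w⟫ =
    (2 * L / d - 2 * L / R) * ⟪v, w⟫ - 2 * L / d * (⟪e, v⟫ * ⟪e, w⟫) := by
  simp only [coneForm, _root_.sub_apply, _root_.smul_apply, ContinuousLinearMap.id_apply,
    ContinuousLinearMap.smulRight_apply, innerSL_apply_apply, inner_sub_left, real_inner_smul_left]

theorem cone_expansion_le {L R d : ℝ} (hL : 0 ≤ L) (hd : 0 < d) {e h : E} (he : ‖e‖ = 1)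
    (hh : ‖h‖ ≤ d / 2) :
    L * (‖d • e + h‖ - ‖d • e + h‖ ^ 2 / R) ≤ L * (d - d ^ 2 / R) +
      ⟪(L * (1 - 2 * d / R)) • e, h⟫ + ⟪coneForm L R d e h, h⟫ / 2 := by
  have h1 := norm_add_le_of_norm_le_half hd he hh
  have h5 : ‖d • e + h‖ ^ 2 = d ^ 2 + 2 * d * ⟪e, h⟫ + ‖h‖ ^ 2 := by
    rw [norm_add_sq_real, norm_smul, he, real_inner_smul_left, Real.norm_of_nonneg hd.le]
    ring
  rw [h5, real_inner_smul_left, inner_coneForm, real_inner_self_eq_norm_sq]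
  calc _ ≤ L * (d + ⟪e, h⟫ + (‖h‖ ^ 2 - ⟪e, h⟫ ^ 2) / d -
        (d ^ 2 + 2 * d * ⟪e, h⟫ + ‖h‖ ^ 2) / R) :=
        mul_le_mul_of_nonneg_left (by linarith) hL
    _ = _ := by ring

end IshiiLions

section IshiiLions

variable {E : Type*} [NormedAddCommGroup E] [InnerProductSpace ℝ E]

theorem IsEllipticForm.contradiction_of_cone {lam K A L R τ f₀ : ℝ} {G : (E →L[ℝ] E) → ℝ}
    (hG : IsEllipticForm lam K G) {d : ℝ} {e : E} (he : ‖e‖ = 1) (hA : 0 ≤ A) (hτ : 0 ≤ τ)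
    {X₁ X₂ : E →L[ℝ] E} (hX : ∀ a b, ⟪X₁ a, a⟫ + ⟪X₂ b, b⟫ ≤
      ⟪coneForm L R d e (a - b), a - b⟫ + 2 * A * ‖a‖ ^ 2 + τ * (‖a‖ ^ 2 + ‖b‖ ^ 2))
    (h₁ : -f₀ ≤ G X₁) (h₂ : G (-X₂) ≤ f₀) :
    8 * lam * L / R ≤ 2 * f₀ + (K + lam) * (2 * A + 2 * τ) := by
  have h := hG X₁ (-X₂) (2 * A + 2 * τ) (8 * L / R - (2 * A + 2 * τ)) e (by positivity) he
    (fun h => by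
      have := hX h h
      rw [sub_self, map_zero, inner_zero_left] at this
      rw [_root_.neg_apply, inner_neg_left]
      linarith)
    (by
      have := hX e (-e)
      rw [sub_neg_eq_add, inner_coneForm, map_neg, inner_neg_left, inner_neg_right, neg_neg, norm_neg,
        inner_add_left, inner_add_right, real_inner_self_eq_norm_sq, he] at this
      rw [_root_.neg_apply, inner_neg_left]
      refine le_trans (by linarith : _ ≤ _) (le_of_le_of_eq this (by ring)))
  have : 8 * lam * L / R = lam * (8 * L / R) := by ring
  rw [this]
  linarith

set_option maxHeartbeats 1000000 in
/-- Ishii–Lions Lipschitz estimate, where the supersolution inequality is only required for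
steep subjets. -/
theorem IsEllipticForm.sub_le_mul_norm_sub [FiniteDimensional ℝ E] {lam K : ℝ}
    {G : (E →L[ℝ] E) → ℝ} (hG : IsEllipticForm lam K G) {u : E → ℝ} {x₀ : E}
    {R S f₀ κ L : ℝ} (hR : 0 < R) (hu : ContinuousOn u (closedBall x₀ R))
    (hS : ∀ x ∈ closedBall x₀ R, ∀ y ∈ closedBall x₀ R, u x - u y ≤ S)
    (hup : ∀ x ∈ ball x₀ R, ∀ p X, UpperJet u x p X → -f₀ ≤ G X)
    (hlo : ∀ y ∈ ball x₀ R, ∀ p X, LowerJet u y p X → κ < ‖p‖ → G X ≤ f₀)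
    (hL : 0 < L) (hLκ : 2 * κ < L) (hLS : S ≤ 3 * L * R / 16)
    (hLf : 2 * f₀ + (K + lam) * (8 * S / R ^ 2) < 8 * lam * L / R)
    {y₁ : E} (hy₁ : ‖x₀ - y₁‖ ≤ R / 4) : u x₀ - u y₁ ≤ L * ‖x₀ - y₁‖ := by
  by_contra! hcon
  have hx₀mem : x₀ ∈ closedBall x₀ R := mem_closedBall_self hR.le
  have hS0 : 0 ≤ S := by simpa using hS x₀ hx₀mem x₀ hx₀mem
  set A := 4 * S / R ^ 2 with hA
  have hA0 : 0 ≤ A := by positivity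
  set m := u x₀ - u y₁ - L * ‖x₀ - y₁‖ with hm
  have hm0 : 0 < m := sub_pos.2 hcon
  set BK := closedBall x₀ R with hBK
  have hBKc : IsCompact BK := isCompact_closedBall x₀ R
  -- uniform continuity
  obtain ⟨ρ₀, hρ₀, huc⟩ := Metric.uniformContinuousOn_iff.1
    (hBKc.uniformContinuousOn_of_continuous hu) (m / 3) (by positivity)
  set ρ := min ρ₀ (R / 8) / 2 with hρ
  have hρpos : 0 < ρ := by positivity
  have hρ1 : ρ < ρ₀ := by
    have := min_le_left ρ₀ (R / 8)
    have : 0 < min ρ₀ (R / 8) := by positivity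
    rw [hρ]; linarith
  have hρ2 : ρ ≤ R / 16 := by
    have := min_le_right ρ₀ (R / 8)
    rw [hρ]; linarith
  set δ := ρ ^ 2 / (2 * (S + 1)) with hδ
  have hδ0 : 0 < δ := by positivity
  have hδS : 2 * δ * S ≤ ρ ^ 2 := by
    rw [hδ]
    have : 2 * (ρ ^ 2 / (2 * (S + 1))) * S = ρ ^ 2 * (S / (S + 1)) := by field_simp
    rw [this]
    refine mul_le_of_le_one_right (by positivity) ?_
    rw [div_le_one (by positivity)]
    linarith
  obtain ⟨U, s, hs, hU, hUle, hUsc, hUc⟩ := exists_supConvolution hBKc ⟨x₀, hx₀mem⟩ hu hδ0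
  obtain ⟨V, t, ht, hV, hVle, hVsc, hVc⟩ := exists_supConvolution hBKc ⟨x₀, hx₀mem⟩ hu.neg hδ0
  have hsx : ∀ x ∈ BK, ‖s x - x‖ ≤ ρ := fun x hx =>
    abs_le_of_sq_le_sq' ((norm_sub_sq_le_of_supConvolution hδ0 hs hU hUle hS hx).trans hδS)
      hρpos.le |>.2
  have htx : ∀ x ∈ BK, ‖t x - x‖ ≤ ρ := fun x hx =>
    abs_le_of_sq_le_sq' ((norm_sub_sq_le_of_supConvolution hδ0 ht hV hVle
      (fun x hx y hy => by simpa [sub_eq_add_neg, add_comm] using hS y hy x hx) hx).trans hδS)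
      hρpos.le |>.2
  have hUV : ∀ x y, U x + V y ≤ S := fun x y => by
    have h1 := hS _ (hs x) _ (ht y)
    rw [hU, hV]
    have h2 : 0 ≤ ‖x - s x‖ ^ 2 / (2 * δ) := by positivity
    have h3 : 0 ≤ ‖y - t y‖ ^ 2 / (2 * δ) := by positivity
    simp only [Pi.neg_apply]
    linarith
  have hUge : ∀ x ∈ BK, u x ≤ U x := fun x hx => by simpa using hUle x x hx
  have hVge : ∀ x ∈ BK, -u x ≤ V x := fun x hx => by simpa using hVle x x hx
  have hdiag : ∀ x ∈ BK, U x + V x < m := fun x hx => by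
    have h1 := huc _ (hs x) x hx (by rw [dist_eq_norm]; exact (hsx x hx).trans_lt hρ1)
    have h2 := huc _ (ht x) x hx (by rw [dist_eq_norm]; exact (htx x hx).trans_lt hρ1)
    rw [Real.dist_eq, abs_lt] at h1 h2
    rw [hU, hV]
    have h4 : 0 ≤ ‖x - s x‖ ^ 2 / (2 * δ) := by positivity
    have h3 : 0 ≤ ‖x - t x‖ ^ 2 / (2 * δ) := by positivity
    simp only [Pi.neg_apply]
    linarith
  -- the maximum of the doubled functional
  set Φ : E × E → ℝ := fun z => U z.1 + V z.2 - L * (‖z.1 - z.2‖ - ‖z.1 - z.2‖ ^ 2 / R) -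
    A * ‖z.1 - x₀‖ ^ 2 with hΦ
  have hΦc : Continuous Φ := by fun_prop
  set Dm : Set (E × E) := {z | ‖z.1 - x₀‖ ≤ R / 2 ∧ ‖z.1 - z.2‖ ≤ R / 4} with hDm
  have hDmB : ∀ z ∈ Dm, ‖z.1 - x₀‖ ≤ R / 2 ∧ ‖z.2 - x₀‖ ≤ 3 * R / 4 := fun z hz => by
    refine ⟨hz.1, ?_⟩
    have := norm_sub_le (z.1 - x₀) (z.1 - z.2)
    rw [sub_sub_sub_cancel_left] at this
    linarith [hz.1, hz.2]
  have hDmc : IsCompact Dm := by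
    refine (hBKc.prod hBKc).of_isClosed_subset ?_ fun z hz => ?_
    · have c1 : Continuous (fun z : E × E => ‖z.1 - x₀‖) := by fun_prop
      have c2 : Continuous (fun z : E × E => ‖z.1 - z.2‖) := by fun_prop
      exact (isClosed_le c1 continuous_const).inter (isClosed_le c2 continuous_const)
    · have := hDmB z hz
      simp only [mem_prod, hBK, mem_closedBall, dist_eq_norm]
      exact ⟨by linarith, by linarith⟩
  have hzmem : (x₀, y₁) ∈ Dm := ⟨by simpa using by positivity, hy₁⟩
  obtain ⟨⟨x, y⟩, hxy, hmax⟩ := hDmc.exists_isMaxOn ⟨_, hzmem⟩ hΦc.continuousOn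
  have hxyB := hDmB _ hxy
  have hxB : x ∈ BK := by rw [hBK, mem_closedBall, dist_eq_norm]; linarith [hxyB.1]
  have hΦm : m ≤ Φ (x, y) := by
    refine le_trans ?_ (hmax hzmem)
    have h1 := hUge x₀ hx₀mem
    have h2 := hVge y₁ (by
      rw [hBK, mem_closedBall, dist_eq_norm, norm_sub_rev]; linarith)
    have h3 : 0 ≤ L * (‖x₀ - y₁‖ ^ 2 / R) := by positivity
    simp only [hΦ, hm, sub_self, norm_zero]
    nlinarith
  set d := ‖x - y‖ with hd
  have hd4 : d ≤ R / 4 := hxy.2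
  have hcone : ∀ r, 0 ≤ r → r ≤ R / 4 → 3 / 4 * r ≤ r - r ^ 2 / R := fun r h0 h1 => by
    have : r ^ 2 / R ≤ r / 4 := by
      rw [div_le_iff₀ hR]
      nlinarith
    linarith
  have hd0 : 0 < d := by
    rcases (norm_nonneg (x - y)).eq_or_lt with h | h
    · exfalso
      have hxy' : x = y := sub_eq_zero.1 (norm_eq_zero.1 h.symm)
      subst hxy'
      have h1 := hdiag x hxB
      simp only [hΦ, sub_self, norm_zero] at hΦm
      have h2 : 0 ≤ A * ‖x - x₀‖ ^ 2 := by positivity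
      have h3 : L * ((0 : ℝ) - 0 ^ 2 / R) = 0 := by simp
      linarith
    · exact h
  have hΦval : Φ (x, y) = U x + V y - L * (d - d ^ 2 / R) - A * ‖x - x₀‖ ^ 2 := rfl
  have hd4' : d < R / 4 := by
    refine lt_of_le_of_ne hd4 fun h => ?_
    have h1 := mul_le_mul_of_nonneg_left (hcone d hd0.le hd4) hL.le
    have h2 : 0 ≤ A * ‖x - x₀‖ ^ 2 := by positivity
    have h3 := hUV x y
    rw [h] at h1 hΦval
    have h4 : L * (3 / 4 * (R / 4)) = 3 * L * R / 16 := by ring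
    linarith
  have hx2 : ‖x - x₀‖ < R / 2 := by
    refine lt_of_le_of_ne hxy.1 fun h => ?_
    have h1 := mul_le_mul_of_nonneg_left (hcone d hd0.le hd4) hL.le
    have h2 : 0 ≤ L * (3 / 4 * d) := by positivity
    have h3 := hUV x y
    have h4 : A * (R / 2) ^ 2 = S := by rw [hA]; field_simp; ring
    rw [h, h4] at hΦval
    linarith
  set e := (1 / d) • (x - y) with he
  have hde : d • e = x - y := by rw [he, smul_smul, mul_one_div_cancel hd0.ne', one_smul]
  have hen : ‖e‖ = 1 := by
    rw [he, norm_smul, ← hd, Real.norm_of_nonneg (by positivity)]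
    exact one_div_mul_cancel hd0.ne'
  set r := min (min ((R / 4 - d) / 2) (R / 2 - ‖x - x₀‖)) (d / 4) with hr
  have hr0 : 0 < r := by
    refine lt_min (lt_min ?_ ?_) ?_ <;> linarith
  have hr1 : r ≤ (R / 4 - d) / 2 := (min_le_left _ _).trans (min_le_left _ _)
  have hr2 : r ≤ R / 2 - ‖x - x₀‖ := (min_le_left _ _).trans (min_le_right _ _)
  have hr3 : r ≤ d / 4 := min_le_right _ _
  set g := L * (1 - 2 * d / R) with hg
  have hquad : ∀ a b, ‖a‖ ≤ r → ‖b‖ ≤ r → U (x + a) + V (y + b) ≤ U x + V y +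
      ⟪g • e + (2 * A) • (x - x₀), a⟫ + ⟪-(g • e), b⟫ +
      (⟪coneForm L R d e (a - b), a - b⟫ + 2 * A * ‖a‖ ^ 2) / 2 := fun a b ha hb => by
    have hab : ‖a - b‖ ≤ 2 * r := (norm_sub_le a b).trans (by linarith)
    have e1 : x + a - (y + b) = d • e + (a - b) := by rw [hde]; abel
    have e2 : x + a - x₀ = (x - x₀) + a := by abel
    have hmem : (x + a, y + b) ∈ Dm := by
      constructor
      · simp only [e2]
        exact (norm_add_le _ _).trans (by linarith)
      · simp only [e1]
        refine (norm_add_le _ _).trans ?_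
        rw [hde]
        linarith
    have h1 : Φ (x + a, y + b) ≤ Φ (x, y) := hmax hmem
    have h2 := cone_expansion_le (R := R) hL.le hd0 hen (h := a - b) (by linarith)
    rw [hΦval] at h1
    simp only [hΦ, e1, e2] at h1
    rw [norm_add_sq_real (x - x₀) a] at h1
    rw [inner_sub_right] at h2
    rw [inner_add_left, inner_neg_left, real_inner_smul_left (x - x₀)]
    rw [← hg] at h2
    linarith
  have hsymm : ∀ v w, ⟪coneForm L R d e v, w⟫ = ⟪coneForm L R d e w, v⟫ := fun v w => by
    rw [inner_coneForm, inner_coneForm, real_inner_comm v w]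
    ring
  -- choose the perturbation parameter
  obtain ⟨τ, hτ0, hτR, hτκ, hτf⟩ : ∃ τ > 0, τ ≤ R / 16 ∧ τ < L / 2 - κ ∧
      2 * f₀ + (K + lam) * (2 * A + 2 * τ) < 8 * lam * L / R := by
    have hev : ∀ᶠ τ : ℝ in 𝓝[>] 0,
        2 * f₀ + (K + lam) * (2 * A + 2 * τ) < 8 * lam * L / R := by
      have hc : Tendsto (fun τ : ℝ => 2 * f₀ + (K + lam) * (2 * A + 2 * τ)) (𝓝 0)
          (𝓝 (2 * f₀ + (K + lam) * (2 * A + 2 * 0))) :=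
        (by fun_prop : Continuous (fun τ : ℝ => 2 * f₀ + (K + lam) * (2 * A + 2 * τ))).tendsto 0
      refine (hc.mono_left nhdsWithin_le_nhds).eventually_lt_const ?_
      have : 2 * A + 2 * 0 = 8 * S / R ^ 2 := by rw [hA]; ring
      rwa [this]
    have hpos : ∀ᶠ τ : ℝ in 𝓝[>] 0, 0 < τ := eventually_mem_nhdsWithin
    have hlt : ∀ c : ℝ, 0 < c → ∀ᶠ τ : ℝ in 𝓝[>] 0, τ < c := fun c hc =>
      nhdsWithin_le_nhds (eventually_lt_nhds hc)
    obtain ⟨τ, h1, h2, h3, h4⟩ := (hpos.and ((hlt (R / 16) (by positivity)).and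
      ((hlt (L / 2 - κ) (by linarith)).and hev))).exists
    exact ⟨τ, h1, h2.le, h3, h4⟩
  obtain ⟨x', y', q₁, q₂, X₁, X₂, hx', hy', -, hq₂, hj₁, hj₂, hX⟩ :=
    exists_jets_of_le_quadratic hUsc hVsc (by positivity) hUc hVc hsymm hr0 hquad hτ0
  have hin : ∀ {z z' w : E}, ‖z - x₀‖ ≤ 3 * R / 4 → ‖z' - z‖ ≤ τ → (z' ∈ BK → ‖w - z'‖ ≤ ρ) →
      w ∈ ball x₀ R := fun {z z' w} h1 h2 h3 => by
    have h4 : ‖z' - x₀‖ ≤ 13 * R / 16 := by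
      have := norm_add_le (z' - z) (z - x₀)
      rw [sub_add_sub_cancel] at this
      linarith
    have h5 := h3 (by rw [hBK, mem_closedBall, dist_eq_norm]; linarith)
    have := norm_add_le (w - z') (z' - x₀)
    rw [sub_add_sub_cancel] at this
    rw [mem_ball, dist_eq_norm]
    linarith
  have hsb := hin (by linarith [hxyB.1] : ‖x - x₀‖ ≤ 3 * R / 4) hx' (hsx x')
  have htb := hin hxyB.2 hy' (htx y')
  have hnhds : ∀ w ∈ ball x₀ R, BK ∈ 𝓝 w := fun w hw =>
    mem_of_superset (isOpen_ball.mem_nhds hw) ball_subset_closedBall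
  have h₁ := hup _ hsb _ _ (hj₁.of_supConvolution hU hUle (hnhds _ hsb))
  have h₂ := hlo _ htb _ _ (hj₂.of_supConvolution hV hVle (hnhds _ htb)).neg (by
    rw [norm_neg]
    have hg2 : L / 2 ≤ g := by
      have : 2 * d / R ≤ 1 / 2 := by rw [div_le_iff₀ hR]; linarith
      rw [hg]
      nlinarith
    have h3 := norm_sub_norm_le (-(g • e)) q₂
    rw [norm_neg, norm_smul, hen, mul_one, Real.norm_of_nonneg (by linarith)] at h3
    have h4 := norm_sub_rev q₂ (-(g • e))
    linarith)
  exact (hG.contradiction_of_cone hen hA0 hτ0.le hX h₁ h₂).not_gt hτf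

end IshiiLions

section Barrier

theorem one_sub_mul_sq_le_inv_pow {x : ℝ} {m : ℕ} (hx : -1 < x) (hm : 0 ≤ 1 - m * x) :
    (1 - m * x) ^ 2 ≤ ((1 + x)⁻¹) ^ (2 * m) := by
  have h1 : 0 < 1 + x := by linarith
  have h2 : (1 + x)⁻¹ = 1 + -(x / (1 + x)) := by field_simp; ring
  have h3 : x / (1 + x) ≤ x := by
    rw [div_le_iff₀ h1]; nlinarith [sq_nonneg x]
  have h4 : -2 ≤ -(x / (1 + x)) := by
    have : 0 < (1 + x)⁻¹ := by positivity
    linarith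
  have h5 := one_add_mul_le_pow h4 m
  have h6 : (m : ℝ) * (x / (1 + x)) ≤ m * x := mul_le_mul_of_nonneg_left h3 (by positivity)
  rw [mul_comm 2 m, pow_mul]
  refine pow_le_pow_left₀ hm ?_ 2
  rw [h2]
  linarith

variable {E : Type*} [NormedAddCommGroup E] [InnerProductSpace ℝ E]

theorem inner_smul_id_add_smulRight (c₁ c₂ : ℝ) (η h : E) :
    ⟪(-c₁ • ContinuousLinearMap.id ℝ E + c₂ • (innerSL ℝ η).smulRight η) h, h⟫ =
      -c₁ * ‖h‖ ^ 2 + c₂ * ⟪η, h⟫ ^ 2 := by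
  simp only [_root_.add_apply, _root_.smul_apply, ContinuousLinearMap.id_apply,
    ContinuousLinearMap.smulRight_apply, innerSL_apply_apply, inner_add_left, real_inner_smul_left,
    real_inner_self_eq_norm_sq]
  ring

theorem lowerJet_of_barrier {v : E → ℝ} {z x : E} {a : ℝ} {m : ℕ} (hz : z ≠ x) (ha : 0 ≤ a)
    (hmin : ∀ᶠ h in 𝓝 (0 : E), a * ((‖z + h - x‖ ^ 2)⁻¹) ^ (2 * m) -
      a * ((‖z - x‖ ^ 2)⁻¹) ^ (2 * m) ≤ v (z + h) - v z) :
    ∃ p, LowerJet v z p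
      (-(4 * m * (a * ((‖z - x‖ ^ 2)⁻¹) ^ (2 * m)) / ‖z - x‖ ^ 2) • ContinuousLinearMap.id ℝ E +
        (8 * m ^ 2 * (a * ((‖z - x‖ ^ 2)⁻¹) ^ (2 * m)) / (‖z - x‖ ^ 2) ^ 2) •
          (innerSL ℝ (z - x)).smulRight (z - x)) := by
  set η := z - x with hη
  set t := ‖η‖ ^ 2 with ht
  have ht0 : 0 < t := by
    have : 0 < ‖η‖ := norm_pos_iff.2 (sub_ne_zero.2 hz)
    positivity
  set α := a * (t⁻¹) ^ (2 * m) with hα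
  have hα0 : 0 ≤ α := by positivity
  refine ⟨-(4 * m * α / t) • η, fun θ hθ => ?_⟩
  set ξ : E → ℝ := fun h => (2 * ⟪η, h⟫ + ‖h‖ ^ 2) / t with hξ
  have hξc : Continuous ξ := by fun_prop
  have hξ0 : ξ 0 = 0 := by simp [hξ]
  have hev1 : ∀ᶠ h in 𝓝 (0 : E), -1 < ξ h :=
    hξc.continuousAt.eventually_const_lt (by simp only [hξ0]; norm_num)
  have hev2 : ∀ᶠ h in 𝓝 (0 : E), 0 < 1 - m * ξ h :=
    (by fun_prop : Continuous fun h => 1 - m * ξ h).continuousAt.eventually_const_lt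
      (by simp only [hξ0]; norm_num)
  have hev3 : ∀ᶠ h in 𝓝 (0 : E), -θ < 4 * m ^ 2 * α / t ^ 2 * ⟪η, h⟫ :=
    (by fun_prop : Continuous fun h => 4 * m ^ 2 * α / t ^ 2 * ⟪η, h⟫).continuousAt.eventually_const_lt
      (by simp only [inner_zero_right, mul_zero]; linarith)
  filter_upwards [hmin, hev1, hev2, hev3] with h h0 h1 h2 h3
  have k1 : ‖z + h - x‖ ^ 2 = t * (1 + ξ h) := by
    have : z + h - x = η + h := by rw [hη]; abel
    rw [this, norm_add_sq_real, hξ]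
    field_simp
    ring
  have k2 := one_sub_mul_sq_le_inv_pow h1 h2.le
  rw [k1, mul_inv, mul_pow, ← mul_assoc, ← hα] at h0
  have k3 := mul_le_mul_of_nonneg_left k2 hα0
  rw [inner_smul_id_add_smulRight, real_inner_smul_left]
  have k4 : α * (1 - m * ξ h) ^ 2 - α = -(4 * m * α / t) * ⟪η, h⟫ +
      (-(4 * m * α / t) * ‖h‖ ^ 2 + 8 * m ^ 2 * α / t ^ 2 * ⟪η, h⟫ ^ 2) / 2 +
      4 * m ^ 2 * α / t ^ 2 * ⟪η, h⟫ * ‖h‖ ^ 2 + m ^ 2 * α / t ^ 2 * ‖h‖ ^ 4 := by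
    simp only [hξ]
    field_simp
    ring
  have k5 := mul_le_mul_of_nonneg_right h3.le (sq_nonneg ‖h‖)
  have k6 : 0 ≤ m ^ 2 * α / t ^ 2 * ‖h‖ ^ 4 := by positivity
  linarith

theorem IsEllipticForm.barrier_le {lam K B : ℝ} {G : (E →L[ℝ] E) → ℝ}
    (hG : IsEllipticForm lam K G) (hG0 : G 0 = 0) {m : ℕ} (hm : 1 ≤ m)
    (hmK : K + 1 ≤ lam * (2 * m - 1)) {η : E} (hη : η ≠ 0) (hη2 : ‖η‖ ≤ 2) {a : ℝ} (ha : 0 ≤ a)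
    (hB : G (-(4 * m * (a * ((‖η‖ ^ 2)⁻¹) ^ (2 * m)) / ‖η‖ ^ 2) • ContinuousLinearMap.id ℝ E +
        (8 * m ^ 2 * (a * ((‖η‖ ^ 2)⁻¹) ^ (2 * m)) / (‖η‖ ^ 2) ^ 2) •
          (innerSL ℝ η).smulRight η) ≤ B) : a * (1 / 16) ^ m ≤ B := by
  have hn : 0 < ‖η‖ := norm_pos_iff.2 hη
  set t := ‖η‖ ^ 2 with ht
  have ht0 : 0 < t := by positivity
  have ht4 : t ≤ 4 := by
    have := pow_le_pow_left₀ hn.le hη2 2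
    rw [ht]; linarith
  set α := a * (t⁻¹) ^ (2 * m) with hα
  have hα0 : 0 ≤ α := by positivity
  have hm' : (1 : ℝ) ≤ m := by exact_mod_cast hm
  have h := hG 0 _ (4 * m * α / t) (8 * m ^ 2 * α / t - 4 * m * α / t) (‖η‖⁻¹ • η) (by positivity)
    (by rw [norm_smul, norm_inv, norm_norm, inv_mul_cancel₀ hn.ne'])
    (fun h => by
      rw [inner_smul_id_add_smulRight (4 * m * α / t) (8 * m ^ 2 * α / t ^ 2) η,
        _root_.zero_apply, inner_zero_left]
      have : 0 ≤ 8 * m ^ 2 * α / t ^ 2 * ⟪η, h⟫ ^ 2 := by positivity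
      linarith)
    (by
      rw [inner_smul_id_add_smulRight (4 * m * α / t) (8 * m ^ 2 * α / t ^ 2) η,
        _root_.zero_apply, inner_zero_left, real_inner_smul_right, real_inner_self_eq_norm_sq,
        norm_smul, norm_inv, norm_norm, inv_mul_cancel₀ hn.ne', ← ht]
      have : (‖η‖⁻¹ * t) ^ 2 = t := by rw [ht]; field_simp
      rw [this]
      apply le_of_eq
      field_simp
      ring)
  rw [hG0] at h
  have h1 : α / t * (4 * m) ≤ B := by
    have h2 : α / t * (4 * m) * (K + 1) ≤ α / t * (4 * m) * (lam * (2 * m - 1)) :=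
      mul_le_mul_of_nonneg_left hmK (by positivity)
    have h3 : K * (4 * m * α / t) - lam * (8 * m ^ 2 * α / t - 4 * m * α / t) =
      α / t * (4 * m) * K - α / t * (4 * m) * (lam * (2 * m - 1)) := by ring
    linarith
  refine le_trans ?_ h1
  have h4 : a * (1 / 16) ^ m ≤ α := by
    rw [hα]
    refine mul_le_mul_of_nonneg_left ?_ ha
    have : (1 / 16 : ℝ) ^ m = (4⁻¹) ^ (2 * m) := by rw [pow_mul]; norm_num
    rw [this]
    exact pow_le_pow_left₀ (by norm_num) (inv_anti₀ ht0 ht4) _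
  have h5 : α = α / t * t := (div_mul_cancel₀ _ ht0.ne').symm
  have h6 : 0 ≤ α / t := by positivity
  nlinarith [mul_le_mul_of_nonneg_left (by linarith : t ≤ 4 * m) h6]

end Barrier

section Growth

variable {E : Type*} [NormedAddCommGroup E] [InnerProductSpace ℝ E]

/-- The constant of the scale-invariant interior Lipschitz estimate. -/
def interiorSlope (lam K : ℝ) : ℝ := 16 / 3 + (K + lam + 1) / lam

theorem one_le_interiorSlope {lam K : ℝ} (hlam : 0 < lam) (hK : 0 ≤ K) :
    1 ≤ interiorSlope lam K := by
  have : 0 ≤ (K + lam + 1) / lam := by positivity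
  unfold interiorSlope
  linarith

theorem IsEllipticForm.sub_le_interiorSlope_mul [FiniteDimensional ℝ E] {lam K : ℝ}
    (hlam : 0 < lam) (hK : 0 ≤ K) {G : (E →L[ℝ] E) → ℝ} (hG : IsEllipticForm lam K G)
    {v : E → ℝ} {x : E} {R S B : ℝ} (hR : 0 < R) (hR1 : R ≤ 1) (hS : 0 < S) (hB : 0 ≤ B)
    (hv : ContinuousOn v (closedBall x R))
    (hosc : ∀ y ∈ closedBall x R, ∀ z ∈ closedBall x R, v y - v z ≤ S)
    (hup : ∀ y ∈ ball x R, ∀ p X, UpperJet v y p X → -B ≤ G X)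
    (hlo : ∀ y ∈ ball x R, ∀ p X, LowerJet v y p X → G X ≤ B)
    {y : E} (hy : ‖x - y‖ ≤ R / 4) :
    v x - v y ≤ interiorSlope lam K * (S + B) / R * ‖x - y‖ := by
  have hC := one_le_interiorSlope hlam hK
  have hL : 0 < interiorSlope lam K * (S + B) / R := by positivity
  have hd : 0 ≤ (K + lam + 1) / lam := by positivity
  refine hG.sub_le_mul_norm_sub (f₀ := B) (κ := -1) hR hv hosc hup
    (fun y hy p X hX _ => hlo y hy p X hX) hL (by linarith) ?_ ?_ hy
  · have : 3 * (interiorSlope lam K * (S + B) / R) * R / 16 =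
        3 / 16 * (16 / 3 + (K + lam + 1) / lam) * (S + B) := by
      unfold interiorSlope; field_simp
    rw [this]
    have h1 : 0 ≤ (K + lam + 1) / lam * (S + B) := by positivity
    nlinarith
  · have h1 : 8 * lam * (interiorSlope lam K * (S + B) / R) / R =
        (8 * (K + lam + 1) * (S + B) + 8 * lam * (16 / 3) * (S + B)) / R ^ 2 := by
      unfold interiorSlope; field_simp; ring
    rw [h1, lt_div_iff₀ (by positivity)]
    have h2 : (2 * B + (K + lam) * (8 * S / R ^ 2)) * R ^ 2 =
        2 * B * R ^ 2 + (K + lam) * 8 * S := by field_simp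
    rw [h2]
    have h3 : R ^ 2 ≤ 1 := pow_le_one₀ hR.le hR1
    have h4 : 2 * B * R ^ 2 ≤ 2 * B * 1 := mul_le_mul_of_nonneg_left h3 (by linarith)
    have h5 : 0 ≤ 8 * lam * (16 / 3) * (S + B) := by positivity
    have h6 : 0 ≤ (K + lam) * B := by positivity
    nlinarith

theorem IsEllipticForm.le_or_le_of_barrier [FiniteDimensional ℝ E] {lam K B : ℝ}
    {G : (E →L[ℝ] E) → ℝ} (hG : IsEllipticForm lam K G) (hG0 : G 0 = 0) {m : ℕ} (hm : 1 ≤ m)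
    (hmK : K + 1 ≤ lam * (2 * m - 1)) {v : E → ℝ} {x : E} {k ρ : ℝ} (hρ : 0 < ρ) (hρ1 : ρ ≤ 1)
    (hk : 0 ≤ k) (hv : ContinuousOn v (closedBall x 2)) (hv0 : ∀ y ∈ closedBall x 2, 0 ≤ v y)
    (hlo : ∀ y ∈ ball x 2, ∀ p X, LowerJet v y p X → G X ≤ B)
    (hvk : ∀ y ∈ closedBall x ρ, k ≤ v y) :
    k * ρ ^ (4 * m) ≤ 16 ^ m * B ∨ ∀ z ∈ closedBall x 1, k * ρ ^ (4 * m) ≤ 2 * v z := by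
  set a := k * ρ ^ (4 * m) with ha
  have ha0 : 0 ≤ a := by positivity
  have hak : a ≤ k := mul_le_of_le_one_right hk (pow_le_one₀ hρ.le hρ1)
  have haρ : a * ((ρ ^ 2)⁻¹) ^ (2 * m) = k := by
    have : (ρ ^ 2) ^ (2 * m) = ρ ^ (4 * m) := by rw [← pow_mul]; congr 1; ring
    rw [inv_pow, this, ha]
    field_simp
  set b : E → ℝ := fun z => a * ((‖z - x‖ ^ 2)⁻¹) ^ (2 * m) - a * (4⁻¹) ^ (2 * m) with hb
  set A := closedBall x 2 \ ball x ρ with hA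
  have hAc : IsCompact A := (isCompact_closedBall x 2).diff isOpen_ball
  have hAx : ∀ z ∈ A, 0 < ‖z - x‖ := fun z hz => by
    have := hz.2
    rw [mem_ball, dist_eq_norm, not_lt] at this
    linarith
  by_cases h : ∀ z ∈ A, b z ≤ v z
  · right
    intro z hz
    rw [mem_closedBall, dist_eq_norm] at hz
    rcases lt_or_ge ‖z - x‖ ρ with hzρ | hzρ
    · have h1 := hvk z (by rw [mem_closedBall, dist_eq_norm]; exact hzρ.le)
      linarith
    · have hzA : z ∈ A := ⟨by rw [mem_closedBall, dist_eq_norm]; linarith,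
        by rw [mem_ball, dist_eq_norm]; linarith⟩
      have h1 := h z hzA
      have h2 : 1 ≤ ((‖z - x‖ ^ 2)⁻¹) ^ (2 * m) := by
        apply one_le_pow₀
        exact (one_le_inv₀ (pow_pos (hAx z hzA) 2)).2 (pow_le_one₀ (norm_nonneg _) hz)
      have h3 : (4⁻¹ : ℝ) ^ (2 * m) ≤ 1 / 2 := by
        calc (4⁻¹ : ℝ) ^ (2 * m) ≤ 4⁻¹ ^ 1 :=
              pow_le_pow_of_le_one (by norm_num) (by norm_num) (by lia)
          _ ≤ 1 / 2 := by norm_num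
      simp only [hb] at h1
      have h4 := mul_le_mul_of_nonneg_left h2 ha0
      have h5 := mul_le_mul_of_nonneg_left h3 ha0
      linarith
  · left
    push Not at h
    obtain ⟨z₀, hz₀, hz₀'⟩ := h
    have hbc : ContinuousOn b A := by
      have : ContinuousOn (fun z => (‖z - x‖ ^ 2)⁻¹) A :=
        ContinuousOn.inv₀ (by fun_prop) fun z hz => (pow_pos (hAx z hz) 2).ne'
      simp only [hb]
      exact (continuousOn_const.mul (this.pow _)).sub continuousOn_const
    obtain ⟨z, hzA, hz⟩ := hAc.exists_isMinOn ⟨z₀, hz₀⟩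
      (f := fun z => v z - b z) ((hv.mono sdiff_subset).sub hbc)
    have hneg : v z - b z < 0 := by
      have := hz hz₀
      simp only [mem_ofPred_eq] at this
      linarith
    have hz2 : ‖z - x‖ ≤ 2 := by simpa [dist_eq_norm] using hzA.1
    have hzρ : ρ ≤ ‖z - x‖ := by simpa [dist_eq_norm] using hzA.2
    have h1 : ‖z - x‖ ≠ 2 := fun h2 => by
      have h3 := hv0 z hzA.1
      have h4 : b z = 0 := by simp only [hb, h2]; norm_num
      linarith
    have h2 : ‖z - x‖ ≠ ρ := fun h2 => by
      have h3 := hvk z (by rw [mem_closedBall, dist_eq_norm, h2])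
      have h4 : b z ≤ k := by
        simp only [hb, h2, haρ]
        have : 0 ≤ a * (4⁻¹ : ℝ) ^ (2 * m) := by positivity
        linarith
      linarith
    have h1' : ‖z - x‖ < 2 := lt_of_le_of_ne hz2 h1
    have h2' : ρ < ‖z - x‖ := lt_of_le_of_ne hzρ (Ne.symm h2)
    have hzx : z ≠ x := fun h3 => by rw [h3, sub_self, norm_zero] at h2'; linarith
    have hcn : ContinuousAt (fun h : E => ‖z + h - x‖) 0 := by fun_prop
    have e1 : ∀ᶠ h in 𝓝 (0 : E), ‖z + h - x‖ < 2 :=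
      hcn.eventually_lt_const (by simpa using h1')
    have e2 : ∀ᶠ h in 𝓝 (0 : E), ρ < ‖z + h - x‖ :=
      hcn.eventually_const_lt (by simpa using h2')
    obtain ⟨p, hp⟩ := lowerJet_of_barrier (v := v) (m := m) hzx ha0 (by
      filter_upwards [e1, e2] with h e1 e2
      have h3 : z + h ∈ A := ⟨by rw [mem_closedBall, dist_eq_norm]; exact e1.le,
        by rw [mem_ball, dist_eq_norm]; exact not_lt.2 e2.le⟩
      have := hz h3
      simp only [mem_ofPred_eq, hb] at this
      linarith)
    have h3 := hG.barrier_le hG0 hm hmK (sub_ne_zero.2 hzx) hz2 ha0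
      (hlo z (by rw [mem_ball, dist_eq_norm]; exact h1') p _ hp)
    have h4 := mul_le_mul_of_nonneg_left h3 (by positivity : (0 : ℝ) ≤ 16 ^ m)
    have h5 : (16 : ℝ) ^ m * (a * (1 / 16) ^ m) = a := by
      rw [mul_left_comm, ← mul_pow]; norm_num
    linarith

theorem IsEllipticForm.exists_growth_const [FiniteDimensional ℝ E] {lam K B T : ℝ}
    (hlam : 0 < lam) (hK : 0 ≤ K) (hB : 0 ≤ B) (hT : 0 ≤ T) :
    ∃ m : ℕ, ∃ C ≥ 0, ∀ G : (E →L[ℝ] E) → ℝ, IsEllipticForm lam K G → G 0 = 0 →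
      ∀ (v : E → ℝ) (y₀ : E), ContinuousOn v (closedBall y₀ 3) →
      (∀ x ∈ closedBall y₀ 3, 0 ≤ v x) →
      (∀ x ∈ ball y₀ 3, ∀ p X, UpperJet v x p X → -B ≤ G X) →
      (∀ x ∈ ball y₀ 3, ∀ p X, LowerJet v x p X → G X ≤ B) → v y₀ ≤ T →
      ∀ x ∈ closedBall y₀ 1, v x * (1 - ‖x - y₀‖) ^ (4 * m) ≤ C := by
  obtain ⟨m₀, hm₀⟩ := exists_nat_gt ((K + 1) / lam)
  set m := m₀ + 1 with hm_def
  have hm : 1 ≤ m := by lia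
  have hmK : K + 1 ≤ lam * (2 * m - 1) := by
    rw [div_lt_iff₀ hlam] at hm₀
    have h1 : (m : ℝ) = m₀ + 1 := by rw [hm_def]; push_cast; rfl
    have h2 : (0 : ℝ) ≤ m₀ := by positivity
    rw [h1]
    nlinarith [mul_nonneg hlam.le h2]
  set C₁ := interiorSlope lam K with hC₁
  have hC1 : 1 ≤ C₁ := one_le_interiorSlope hlam hK
  set c := 1 / (8 * (C₁ * (16 ^ m + 1))) with hc
  have h16 : (1 : ℝ) ≤ 16 ^ m := one_le_pow₀ (by norm_num)
  have hD : 1 ≤ C₁ * (16 ^ m + 1) := one_le_mul_of_one_le_of_one_le hC1 (by linarith)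
  have hc0 : 0 < c := by positivity
  have hcC : c * (C₁ * (16 ^ m + 1)) = 1 / 8 := by rw [hc]; field_simp
  have hc8 : c ≤ 1 / 8 := by
    rw [← hcC]; exact le_mul_of_one_le_right hc0.le hD
  refine ⟨m, B + 2 / c ^ (4 * m) * (16 ^ m * B + 2 * T), by positivity, ?_⟩
  intro G hG hG0 v y₀ hv hv0 hup hlo hvT
  have hball : closedBall y₀ 1 ⊆ closedBall y₀ 3 := closedBall_subset_closedBall (by norm_num)
  obtain ⟨x₁, hx₁, hmax⟩ := (isCompact_closedBall y₀ 1).exists_isMaxOn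
    ⟨y₀, mem_closedBall_self zero_le_one⟩
    (f := fun x => v x * (1 - ‖x - y₀‖) ^ (4 * m))
    ((hv.mono hball).mul (by fun_prop))
  intro x hx
  refine (hmax hx).trans ?_
  clear hx x
  simp only
  set k := v x₁ with hk
  set d := 1 - ‖x₁ - y₀‖ with hd
  have hk0 : 0 ≤ k := hv0 _ (hball hx₁)
  have hx1n : ‖x₁ - y₀‖ ≤ 1 := by simpa [dist_eq_norm] using hx₁
  have hd0 : 0 ≤ d := by rw [hd]; linarith
  have hd1 : d ≤ 1 := by rw [hd]; linarith [norm_nonneg (x₁ - y₀)]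
  have hC0 : 0 ≤ 2 / c ^ (4 * m) * (16 ^ m * B + 2 * T) := by positivity
  rcases le_or_gt k B with hkB | hkB
  · have : k * d ^ (4 * m) ≤ k * 1 := mul_le_mul_of_nonneg_left (pow_le_one₀ hd0 hd1) hk0
    linarith
  rcases hd0.eq_or_lt with hd00 | hdpos
  · rw [← hd00, zero_pow (by lia), mul_zero]
    positivity
  have hkpos : 0 < k := by linarith
  have hsub : closedBall x₁ (d / 2) ⊆ closedBall y₀ 1 := by
    apply closedBall_subset_closedBall'
    rw [dist_eq_norm]; linarith
  have hvS : ∀ x ∈ closedBall x₁ (d / 2), v x ≤ 16 ^ m * k := by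
    intro x hx
    have h1 := hmax (hsub hx)
    simp only [mem_ofPred_eq] at h1
    have h2 : d / 2 ≤ 1 - ‖x - y₀‖ := by
      rw [mem_closedBall, dist_eq_norm] at hx
      have := norm_sub_le_norm_sub_add_norm_sub x x₁ y₀
      linarith
    have h3 : v x * (d / 2) ^ (4 * m) ≤ k * d ^ (4 * m) :=
      (mul_le_mul_of_nonneg_left (pow_le_pow_left₀ (by positivity) h2 _)
        (hv0 _ (hball (hsub hx)))).trans h1
    have h4 : d ^ (4 * m) = 16 ^ m * (d / 2) ^ (4 * m) := by
      have : (16 : ℝ) ^ m = 2 ^ (4 * m) := by rw [pow_mul]; norm_num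
      rw [this, ← mul_pow]; congr 1; ring
    rw [h4] at h3
    refine le_of_mul_le_mul_right (h3.trans_eq ?_) (by positivity : 0 < (d / 2) ^ (4 * m))
    ring
  have hballd : ball x₁ (d / 2) ⊆ ball y₀ 3 :=
    ball_subset_ball' (by rw [dist_eq_norm]; linarith)
  have hhalf : ∀ y ∈ closedBall x₁ (c * d), k / 2 ≤ v y := by
    intro y hy
    rw [mem_closedBall, dist_comm, dist_eq_norm] at hy
    have h1 := hG.sub_le_interiorSlope_mul hlam hK (v := v) (x := x₁) (R := d / 2)
      (S := 16 ^ m * k) (B := B) (by positivity) (by linarith) (by positivity) hB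
      (hv.mono (hsub.trans hball))
      (fun y hy z hz => by linarith [hvS y hy, hv0 z (hball (hsub hz))])
      (fun y hy => hup y (hballd hy)) (fun y hy => hlo y (hballd hy)) (y := y)
      (by nlinarith)
    have h2 : interiorSlope lam K * (16 ^ m * k + B) / (d / 2) * ‖x₁ - y‖ ≤
        C₁ * (16 ^ m * k + k) / (d / 2) * (c * d) := by
      rw [← hC₁]
      gcongr
    have h3 : C₁ * (16 ^ m * k + k) / (d / 2) * (c * d) = 2 * k * (c * (C₁ * (16 ^ m + 1))) := by
      field_simp
    rw [h3, hcC] at h2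
    linarith
  have hsub2 : closedBall x₁ 2 ⊆ closedBall y₀ 3 :=
    closedBall_subset_closedBall' (by rw [dist_eq_norm]; linarith)
  have hsub2' : ball x₁ 2 ⊆ ball y₀ 3 := ball_subset_ball' (by rw [dist_eq_norm]; linarith)
  have hfin := hG.le_or_le_of_barrier hG0 hm hmK (v := v) (x := x₁) (k := k / 2) (ρ := c * d)
    (B := B) (by positivity) (by nlinarith) (by positivity) (hv.mono hsub2)
    (fun y hy => hv0 y (hsub2 hy)) (fun y hy => hlo y (hsub2' hy)) hhalf
  have hle : k / 2 * (c * d) ^ (4 * m) ≤ 16 ^ m * B + 2 * T := by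
    have hB' : 0 ≤ 16 ^ m * B := by positivity
    rcases hfin with h | h
    · linarith
    · have := h y₀ (by rw [mem_closedBall, dist_comm, dist_eq_norm]; exact hx1n)
      linarith
  have h1 : k * d ^ (4 * m) = 2 / c ^ (4 * m) * (k / 2 * (c * d) ^ (4 * m)) := by
    rw [mul_pow]; field_simp
  rw [h1]
  have := mul_le_mul_of_nonneg_left hle (by positivity : 0 ≤ 2 / c ^ (4 * m))
  linarith

theorem IsEllipticForm.exists_slope_const [FiniteDimensional ℝ E] {lam K B T : ℝ}
    (hlam : 0 < lam) (hK : 0 ≤ K) (hB : 0 ≤ B) (hT : 0 ≤ T) :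
    ∃ C > 0, ∀ G : (E →L[ℝ] E) → ℝ, IsEllipticForm lam K G → G 0 = 0 →
      ∀ (v : E → ℝ) (y₀ : E), ContinuousOn v (closedBall y₀ 3) →
      (∀ x ∈ closedBall y₀ 3, 0 ≤ v x) →
      (∀ x ∈ ball y₀ 3, ∀ p X, UpperJet v x p X → -B ≤ G X) →
      (∀ x ∈ ball y₀ 3, ∀ p X, LowerJet v x p X → G X ≤ B) → v y₀ ≤ T →
      ∀ y, ‖y₀ - y‖ ≤ 1 / 8 → v y₀ - v y ≤ C * ‖y₀ - y‖ := by
  obtain ⟨m, C₂, hC₂, h⟩ := IsEllipticForm.exists_growth_const (E := E) hlam hK hB hT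
  have hC1 := one_le_interiorSlope hlam hK
  refine ⟨interiorSlope lam K * ((16 ^ m * C₂ + 1) + B) / (1 / 2), by positivity, ?_⟩
  intro G hG hG0 v y₀ hv hv0 hup hlo hvT y hy
  have hgr := h G hG hG0 v y₀ hv hv0 hup hlo hvT
  have hsub : closedBall y₀ (1 / 2) ⊆ closedBall y₀ 3 := closedBall_subset_closedBall (by norm_num)
  have hsub' : ball y₀ (1 / 2) ⊆ ball y₀ 3 := ball_subset_ball (by norm_num)
  have hvS : ∀ x ∈ closedBall y₀ (1 / 2), v x ≤ 16 ^ m * C₂ := by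
    intro x hx
    have h1 := hgr x (closedBall_subset_closedBall (by norm_num) hx)
    have h2 : 1 / 2 ≤ 1 - ‖x - y₀‖ := by
      rw [mem_closedBall, dist_eq_norm] at hx
      linarith
    have h3 : v x * (1 / 2) ^ (4 * m) ≤ C₂ :=
      (mul_le_mul_of_nonneg_left (pow_le_pow_left₀ (by norm_num) h2 _) (hv0 x (hsub hx))).trans h1
    have h4 : (16 : ℝ) ^ m * (1 / 2) ^ (4 * m) = 1 := by
      rw [pow_mul, ← mul_pow]; norm_num
    calc v x = 16 ^ m * (v x * (1 / 2) ^ (4 * m)) := by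
          rw [mul_left_comm, h4, mul_one]
      _ ≤ 16 ^ m * C₂ := mul_le_mul_of_nonneg_left h3 (by positivity)
  exact hG.sub_le_interiorSlope_mul hlam hK (by norm_num) (by norm_num) (by positivity) hB
    (hv.mono hsub) (fun y hy z hz => by linarith [hvS y hy, hv0 z (hsub hz)])
    (fun y hy => hup y (hsub' hy)) (fun y hy => hlo y (hsub' hy)) (by linarith)

end Growth

section Rescaling

variable {E : Type*} [NormedAddCommGroup E] [InnerProductSpace ℝ E]

theorem LowerJet.of_rescale {u : E → ℝ} {y z p : E} {X : E →L[ℝ] E} {ε c : ℝ} (hε : 0 < ε)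
    (h : LowerJet (fun z => (u (y + ε • z) - c) / ε) z p X) :
    LowerJet u (y + ε • z) p (ε⁻¹ • X) := by
  intro θ hθ
  have ht : Tendsto (fun k : E => ε⁻¹ • k) (𝓝 0) (𝓝 0) := by
    have : Tendsto (fun k : E => ε⁻¹ • k) (𝓝 0) (𝓝 (ε⁻¹ • (0 : E))) :=
      (continuous_const_smul _).tendsto 0
    rwa [smul_zero] at this
  filter_upwards [ht.eventually (h (ε * θ) (by positivity))] with k hk
  have h1 : y + ε • (z + ε⁻¹ • k) = y + ε • z + k := by
    rw [smul_add, smul_smul, mul_inv_cancel₀ hε.ne', one_smul, add_assoc]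
  rw [h1, norm_smul, map_smul, real_inner_smul_left, real_inner_smul_right, real_inner_smul_right,
    Real.norm_of_nonneg (by positivity : 0 ≤ ε⁻¹), le_div_iff₀ hε] at hk
  rw [_root_.smul_apply, real_inner_smul_left]
  have h2 : ((u (y + ε • z) - c) / ε + ε⁻¹ * ⟪p, k⟫ + ε⁻¹ * (ε⁻¹ * ⟪X k, k⟫) / 2 -
      ε * θ * (ε⁻¹ * ‖k‖) ^ 2) * ε =
      u (y + ε • z) - c + ⟪p, k⟫ + ε⁻¹ * ⟪X k, k⟫ / 2 - θ * ‖k‖ ^ 2 := by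
    field_simp
  linarith

theorem UpperJet.of_rescale {u : E → ℝ} {y z p : E} {X : E →L[ℝ] E} {ε c : ℝ} (hε : 0 < ε)
    (h : UpperJet (fun z => (u (y + ε • z) - c) / ε) z p X) :
    UpperJet u (y + ε • z) p (ε⁻¹ • X) := by
  have h1 : LowerJet (fun z => (-u (y + ε • z) - -c) / ε) z (-p) (-X) := by
    intro θ hθ
    filter_upwards [h θ hθ] with k hk
    simp only [inner_neg_left, _root_.neg_apply, neg_sub_neg]
    have h2 : ∀ a : ℝ, (c - a) / ε = -((a - c) / ε) := fun a => by ring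
    rw [h2, h2]
    linarith
  intro θ hθ
  filter_upwards [LowerJet.of_rescale (u := fun x => -u x) (c := -c) hε h1 θ hθ] with k hk
  simp only [inner_neg_left, _root_.neg_apply, smul_neg] at hk
  linarith

theorem IsEllipticForm.rescale {lam K ε : ℝ} (hε : 0 < ε) {G : (E →L[ℝ] E) → ℝ}
    (hG : IsEllipticForm lam K G) : IsEllipticForm lam K (fun X => ε * G (ε⁻¹ • X)) := by
  intro X Y μ ν e hμ he h1 h2
  have h := hG (ε⁻¹ • X) (ε⁻¹ • Y) (ε⁻¹ * μ) (ε⁻¹ * ν) e (by positivity) he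
    (fun h => by
      rw [_root_.smul_apply, _root_.smul_apply, real_inner_smul_left, real_inner_smul_left,
        ← mul_sub, mul_assoc]
      exact mul_le_mul_of_nonneg_left (h1 h) (by positivity))
    (by
      rw [_root_.smul_apply, _root_.smul_apply, real_inner_smul_left, real_inner_smul_left,
        ← mul_sub, ← mul_neg]
      exact mul_le_mul_of_nonneg_left h2 (by positivity))
  have h3 := mul_le_mul_of_nonneg_left h hε.le
  have h4 : ε * (K * (ε⁻¹ * μ) - lam * (ε⁻¹ * ν)) = K * μ - lam * ν := by field_simp
  rw [h4] at h3
  simp only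
  linarith

variable [CompleteSpace E]

theorem norm_gradient_le_of_eventually_sub_le {u : E → ℝ} {x : E} {L : ℝ}
    (hu : DifferentiableAt ℝ u x) (hL : 0 ≤ L)
    (h : ∀ᶠ k in 𝓝 (0 : E), u x - u (x + k) ≤ L * ‖k‖) : ‖gradient u x‖ ≤ L := by
  set g := gradient u x with hg
  rcases (norm_nonneg g).eq_or_lt with hg0 | hg0
  · rw [← hg0]; exact hL
  refine le_of_forall_pos_le_add fun θ hθ => ?_
  have h1 := (hasFDerivAt_iff_isLittleO_nhds_zero.1 hu.hasGradientAt.hasFDerivAt).def hθ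
  have ht : Tendsto (fun t : ℝ => (-t) • g) (𝓝[>] 0) (𝓝 0) := by
    have : Tendsto (fun t : ℝ => (-t) • g) (𝓝 0) (𝓝 ((-0 : ℝ) • g)) :=
      (by fun_prop : Continuous fun t : ℝ => (-t) • g).tendsto 0
    rw [neg_zero, zero_smul] at this
    exact this.mono_left nhdsWithin_le_nhds
  obtain ⟨t, ⟨h2, h3⟩, ht0⟩ := ((ht.eventually (h.and h1)).and self_mem_nhdsWithin).exists
  have ht0' : 0 < t := ht0
  rw [← hg, InnerProductSpace.toDual_apply_apply, real_inner_smul_right,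
    real_inner_self_eq_norm_sq, norm_smul, Real.norm_eq_abs, Real.norm_eq_abs, abs_neg,
    abs_of_pos ht0'] at h3
  rw [norm_smul, Real.norm_eq_abs, abs_neg, abs_of_pos ht0'] at h2
  have h4 := (abs_le.1 h3).2
  have h5 : ‖g‖ * (t * ‖g‖) ≤ (L + θ) * (t * ‖g‖) := by nlinarith
  exact le_of_mul_le_mul_right h5 (by positivity)

theorem LowerJet.eq_gradient {u : E → ℝ} {x p : E} {X : E →L[ℝ] E} (h : LowerJet u x p X)
    (hu : DifferentiableAt ℝ u x) : p = gradient u x := by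
  set S : E →L[ℝ] E := X - (2 : ℝ) • ContinuousLinearMap.id ℝ E with hS
  have hmin : IsLocalMin (fun y => u y - (⟪p, y - x⟫ + ⟪S (y - x), y - x⟫ / 2)) x := by
    refine eventually_add_of_eventually ?_
    filter_upwards [h 1 one_pos] with k hk
    simp only [sub_self, inner_zero_right, add_sub_cancel_left, hS, _root_.sub_apply,
      _root_.smul_apply, ContinuousLinearMap.id_apply, inner_sub_left, real_inner_smul_left,
      real_inner_self_eq_norm_sq]
    linarith
  have h1 := hmin.hasFDerivAt_eq_zero
    (hu.hasGradientAt.hasFDerivAt.sub (hasFDerivAt_quadratic x p S x))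
  rw [sub_self, map_zero, add_zero, sub_eq_zero] at h1
  exact ((InnerProductSpace.toDual ℝ E).injective h1).symm

end Rescaling

section Lipschitz

variable {E : Type*} [NormedAddCommGroup E] [InnerProductSpace ℝ E] [FiniteDimensional ℝ E]

theorem IsEllipticForm.exists_gradient_const {lam K : ℝ} (hlam : 0 < lam) (hK : 0 ≤ K)
    {R S f₀ κ : ℝ} (hR : 0 < R) (hS : 0 ≤ S) (hf₀ : 0 ≤ f₀) :
    ∃ L > 0, ∀ G : (E →L[ℝ] E) → ℝ, IsEllipticForm lam K G → ∀ (u : E → ℝ) (x₀ : E),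
      ContinuousOn u (closedBall x₀ R) → DifferentiableAt ℝ u x₀ →
      (∀ x ∈ closedBall x₀ R, ∀ y ∈ closedBall x₀ R, u x - u y ≤ S) →
      (∀ x ∈ ball x₀ R, ∀ p X, UpperJet u x p X → -f₀ ≤ G X) →
      (∀ y ∈ ball x₀ R, ∀ p X, LowerJet u y p X → κ < ‖p‖ → G X ≤ f₀) →
      ‖gradient u x₀‖ ≤ L := by
  set Q := (2 * f₀ + (K + lam) * (8 * S / R ^ 2)) * R / (8 * lam) with hQ
  have hQ0 : 0 ≤ Q := by positivity
  have hS0 : 0 ≤ 16 * S / (3 * R) := by positivity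
  set L := 1 + 2 * |κ| + 16 * S / (3 * R) + Q with hL
  have hL0 : 0 < L := by positivity
  refine ⟨L, hL0, fun G hG u x₀ hu hd hosc hup hlo => ?_⟩
  refine norm_gradient_le_of_eventually_sub_le hd hL0.le ?_
  filter_upwards [closedBall_mem_nhds (0 : E) (by positivity : 0 < R / 4)] with k hk
  have hk' : ‖x₀ - (x₀ + k)‖ = ‖k‖ := by rw [sub_add_cancel_left, norm_neg]
  have := hG.sub_le_mul_norm_sub hR hu hosc hup hlo hL0
    (by linarith [le_abs_self κ, abs_nonneg κ])
    (by
      have h1 : S = 3 * (16 * S / (3 * R)) * R / 16 := by field_simp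
      have h2 : 16 * S / (3 * R) ≤ L := by linarith [abs_nonneg κ]
      calc S = 3 * (16 * S / (3 * R)) * R / 16 := h1
        _ ≤ 3 * L * R / 16 := by gcongr)
    (by
      have h1 : 2 * f₀ + (K + lam) * (8 * S / R ^ 2) = 8 * lam * Q / R := by
        rw [hQ]; field_simp
      have h2 : Q < L := by linarith [abs_nonneg κ]
      rw [h1]
      gcongr)
    (y₁ := x₀ + k) (by rw [hk']; simpa using hk)
  rwa [hk'] at this

end Lipschitz

theorem exists_layer_slope_const {n : ℕ} {lam K B T Lφ : ℝ} (hlam : 0 < lam) (hK : 0 ≤ K)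
    (hB : 0 ≤ B) (hT : 0 ≤ T) (hLφ : 0 ≤ Lφ) {β : ℝ → ℝ} (hβ0 : ∀ s, 0 ≤ β s)
    (hβB : ∀ s, β s ≤ B) {e : Euc n} (he : ‖e‖ = 1) :
    ∃ C > 0, ∀ F : Matrix (Fin n) (Fin n) ℝ → ℝ,
      IsEllipticForm lam K (fun X : Euc n →L[ℝ] Euc n => F (symMat X)) → F 0 = 0 →
      ∀ (Ω : Set (Euc n)) (φ u : Euc n → ℝ) (ε : ℝ), 0 < ε →
      (∀ x ∈ Ω, ∀ y ∈ Ω, |φ x - φ y| ≤ Lφ * ‖x - y‖) → ContinuousOn u Ω →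
      (∀ x ∈ Ω, φ x ≤ u x) →
      ViscSol (fun _ N => F N) (fun x => ε⁻¹ * β ((u x - φ x) / ε)) Ω u →
      ∀ y, closedBall y (3 * ε) ⊆ Ω → DifferentiableAt ℝ u y → (u y - φ y) / ε ≤ T →
      ‖gradient u y‖ ≤ C := by
  obtain ⟨C, hC, h⟩ := IsEllipticForm.exists_slope_const (E := Euc n) (T := T + 3 * Lφ)
    hlam hK hB (by positivity)
  refine ⟨C, hC, fun F hF hF0 Ω φ u ε hε hφ hu hφu hvisc y hy hdiff hyT => ?_⟩
  set c := φ y - 3 * Lφ * ε with hc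
  have hmaps : ∀ z ∈ closedBall (0 : Euc n) 3, y + ε • z ∈ Ω := fun z hz => by
    apply hy
    rw [mem_closedBall, dist_eq_norm, add_sub_cancel_left, norm_smul, Real.norm_of_nonneg hε.le]
    rw [mem_closedBall_zero_iff] at hz
    nlinarith
  have hyΩ : y ∈ Ω := hy (mem_closedBall_self (by positivity))
  have hest := h (fun X => ε * F (symMat (ε⁻¹ • X))) (hF.rescale hε)
    (by rw [smul_zero, symMat_zero, hF0, mul_zero]) (fun z => (u (y + ε • z) - c) / ε) 0
    ((((hu.comp (by fun_prop) hmaps : ContinuousOn (fun z => u (y + ε • z)) _)).sub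
      continuousOn_const).div_const ε)
    (fun z hz => by
      have h1 := hφ _ hyΩ _ (hmaps z hz)
      rw [sub_add_cancel_left, norm_neg, norm_smul, Real.norm_of_nonneg hε.le] at h1
      have h2 := hφu _ (hmaps z hz)
      have h3 : Lφ * (ε * ‖z‖) ≤ Lφ * (ε * 3) := by
        have : ‖z‖ ≤ 3 := mem_closedBall_zero_iff.1 hz
        gcongr
      have h4 := (abs_le.1 h1).2
      refine div_nonneg ?_ hε.le
      rw [hc]; linarith)
    (fun z hz p X hX => by
      have h1 := hvisc.le_of_upperJet hF he (hmaps z (ball_subset_closedBall hz))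
        (UpperJet.of_rescale hε hX)
      have h2 : 0 ≤ ε⁻¹ * β ((u (y + ε • z) - φ (y + ε • z)) / ε) :=
        mul_nonneg (by positivity) (hβ0 _)
      have h3 : 0 ≤ ε * F (symMat (ε⁻¹ • X)) := mul_nonneg hε.le (h2.trans h1)
      linarith)
    (fun z hz p X hX => by
      have h1 := hvisc.le_of_lowerJet hF he (hmaps z (ball_subset_closedBall hz))
        (LowerJet.of_rescale hε hX)
      have h2 := mul_le_mul_of_nonneg_left h1 hε.le
      rw [← mul_assoc, mul_inv_cancel₀ hε.ne', one_mul] at h2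
      exact h2.trans (hβB _))
    (by
      rw [smul_zero, add_zero, hc]
      have : (u y - (φ y - 3 * Lφ * ε)) / ε = (u y - φ y) / ε + 3 * Lφ := by
        field_simp; ring
      rw [this]; linarith)
  refine norm_gradient_le_of_eventually_sub_le hdiff hC.le ?_
  filter_upwards [closedBall_mem_nhds (0 : Euc n) (by positivity : 0 < ε / 8)] with k hk
  rw [mem_closedBall_zero_iff] at hk
  have hn : ‖(0 : Euc n) - ε⁻¹ • k‖ = ε⁻¹ * ‖k‖ := by
    rw [zero_sub, norm_neg, norm_smul, Real.norm_of_nonneg (by positivity : 0 ≤ ε⁻¹)]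
  have h1 := hest (ε⁻¹ • k) (by
    rw [hn, inv_mul_le_iff₀ hε]; linarith)
  rw [hn, smul_zero, add_zero, smul_smul, mul_inv_cancel₀ hε.ne', one_smul, ← sub_div,
    div_le_iff₀ hε, sub_sub_sub_cancel_right] at h1
  have h2 : C * (ε⁻¹ * ‖k‖) * ε = C * ‖k‖ := by field_simp
  linarith

end Regularity

/-- Section 6.3: uniform-in-`ε` gradient bound for the penalized
flame-propagation problem with an obstacle. -/
theorem flame_propagation_gradient_bound
    (n : ℕ) (hn : 1 ≤ n) (lam Lam : ℝ) (hlam : 0 < lam) (hlamLam : lam ≤ Lam)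
    (β : ℝ → ℝ) (hβs : ContDiff ℝ (⊤ : ℕ∞) β) (hβ0 : ∀ s, 0 ≤ β s)
    (hβc : HasCompactSupport β)
    (Ω Ω' : Set (Euc n)) (hΩ : IsOpen Ω) (hΩb : Bornology.IsBounded Ω)
    (hΩ' : IsOpen Ω') (hsub : closure Ω' ⊆ Ω) (hcpt : IsCompact (closure Ω'))
    (Lφ M : ℝ) (hLφ : 0 ≤ Lφ) (hM : 0 ≤ M) :
    ∃ C' > 0,
      ∀ F : Matrix (Fin n) (Fin n) ℝ → ℝ, IsUniformlyElliptic n lam Lam F →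
        F 0 = 0 →
      ∀ φ : Euc n → ℝ,
        (∀ x ∈ Ω, ∀ y ∈ Ω, |φ x - φ y| ≤ Lφ * ‖x - y‖) →
      ∀ uε : ℝ → Euc n → ℝ,
        (∀ ε : ℝ, 0 < ε →
          ContDiffOn ℝ 1 (uε ε) Ω ∧
          (∀ x ∈ Ω, φ x ≤ uε ε x) ∧
          (∀ x ∈ Ω, |uε ε x| ≤ M) ∧
          ViscSol (fun _ N => F N) (fun x => ε⁻¹ * β ((uε ε x - φ x) / ε))
            Ω (uε ε)) →
        ∀ ε : ℝ, 0 < ε → ∀ x ∈ Ω', ‖gradient (uε ε) x‖ ≤ C' := by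
  have hK : (0 : ℝ) ≤ n * Lam := mul_nonneg (by positivity) (hlam.le.trans hlamLam)
  obtain ⟨e, he⟩ : ∃ e : Euc n, ‖e‖ = 1 := ⟨EuclideanSpace.single ⟨0, hn⟩ 1, by simp⟩
  obtain ⟨r, hr, hrΩ⟩ := hcpt.exists_cthickening_subset_open hΩ hsub
  have hball : ∀ x ∈ Ω', closedBall x r ⊆ Ω := fun x hx =>
    (closedBall_subset_cthickening (subset_closure hx) r).trans hrΩ
  obtain ⟨B, hβB'⟩ := hβs.continuous.bounded_above_of_compact_support hβc
  have hβB : ∀ s, β s ≤ B := fun s => (le_abs_self _).trans (hβB' s)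
  have hB : 0 ≤ B := (hβ0 0).trans (hβB 0)
  obtain ⟨T, hT, hβT⟩ : ∃ T, 0 ≤ T ∧ ∀ s, T < s → β s = 0 := by
    obtain ⟨T, hT⟩ := hβc.isCompact.isBounded.subset_closedBall 0
    refine ⟨|T|, abs_nonneg T, fun s hs => ?_⟩
    by_contra h
    have h1 := hT (subset_tsupport β h)
    rw [mem_closedBall_zero_iff, Real.norm_eq_abs] at h1
    linarith [le_abs_self s, le_abs_self T]
  obtain ⟨C₀, hC₀, hlayer⟩ := exists_layer_slope_const (n := n) hlam hK hB hT hLφ hβ0 hβB he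
  obtain ⟨L₁, hL₁, hlip₁⟩ := IsEllipticForm.exists_gradient_const (E := Euc n) hlam hK
    (R := r) (S := 2 * M) (f₀ := (r / 8)⁻¹ * B) (κ := C₀) hr (by positivity) (by positivity)
  obtain ⟨L₂, hL₂, hlip₂⟩ := IsEllipticForm.exists_gradient_const (E := Euc n) hlam hK
    (R := r / 2) (S := 2 * M) (f₀ := 0) (κ := C₀) (by positivity) (by positivity) le_rfl
  refine ⟨max L₁ L₂, lt_max_of_lt_left hL₁, ?_⟩
  intro F hF hF0 φ hφ uε huε ε hε x hx
  obtain ⟨hC1, hφu, hMu, hvisc⟩ := huε ε hε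
  have hG := hF.isEllipticForm hlam.le hlamLam
  have hdiff : ∀ y ∈ Ω, DifferentiableAt ℝ (uε ε) y := fun y hy =>
    (hC1.differentiableOn one_ne_zero).differentiableAt (hΩ.mem_nhds hy)
  have hxΩ : x ∈ Ω := hball x hx (mem_closedBall_self hr.le)
  have hosc : ∀ y ∈ Ω, ∀ z ∈ Ω, uε ε y - uε ε z ≤ 2 * M := fun y hy z hz => by
    linarith [(abs_le.1 (hMu y hy)).2, (abs_le.1 (hMu z hz)).1]
  have hf0 : ∀ y, 0 ≤ ε⁻¹ * β ((uε ε y - φ y) / ε) := fun y =>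
    mul_nonneg (by positivity) (hβ0 _)
  rcases le_or_gt (r / 8) ε with hεr | hεr
  · have hb := hball x hx
    have hb' := ball_subset_closedBall.trans hb
    refine (hlip₁ _ hG _ x (hC1.continuousOn.mono hb) (hdiff x hxΩ)
      (fun y hy z hz => hosc y (hb hy) z (hb hz)) (fun y hy p X hX => ?_)
      (fun y hy p X hX _ => ?_)).trans (le_max_left _ _)
    · have h1 := hvisc.le_of_upperJet hG he (hb' hy) hX
      have h2 : 0 ≤ (r / 8)⁻¹ * B := by positivity
      linarith [hf0 y]
    · refine (hvisc.le_of_lowerJet hG he (hb' hy) hX).trans ?_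
      exact mul_le_mul (inv_anti₀ (by positivity) hεr) (hβB _) (hβ0 _) (by positivity)
  · have hb : closedBall x (r / 2) ⊆ Ω :=
      (closedBall_subset_closedBall (by linarith)).trans (hball x hx)
    have hb' := ball_subset_closedBall.trans hb
    refine (hlip₂ _ hG _ x (hC1.continuousOn.mono hb) (hdiff x hxΩ)
      (fun y hy z hz => hosc y (hb hy) z (hb hz)) (fun y hy p X hX => ?_)
      (fun y hy p X hX hp => ?_)).trans (le_max_right _ _)
    · have h1 := hvisc.le_of_upperJet hG he (hb' hy) hX
      linarith [hf0 y]
    · refine (hvisc.le_of_lowerJet hG he (hb' hy) hX).trans ?_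
      rcases le_or_gt ((uε ε y - φ y) / ε) T with hyT | hyT
      · have hy3 : closedBall y (3 * ε) ⊆ Ω := by
          refine (closedBall_subset_closedBall' ?_).trans (hball x hx)
          have := mem_ball.1 hy
          linarith
        have h1 := hlayer F hG hF0 Ω φ (uε ε) ε hε hφ hC1.continuousOn hφu hvisc y hy3
          (hdiff y (hb' hy)) hyT
        rw [hX.eq_gradient (hdiff y (hb' hy))] at hp
        linarith
      · simp only [hβT _ hyT, mul_zero, le_refl]

end
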